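/- arXiv:1612.04586 — 2 statements merged into one kernel-verified Lean document; each statement's English description precedes it below -/
import Mathlib

section
/- Let 𝔤 = 𝔰𝔩_n(ℂ), n ≥ 2, with the notation below. Define r(x,y) = (x/(y−x))·γ + r₀, where r₀ = (1/(2n)) Σ_{j=1}^{n−1} g_{n−j}⊗g_j + Σ_{α∈Φ₊} e_{−α}⊗e_α + (1/(2n)) Σ_{j=1}^{n−1} ((1+ζ_j)/(1−ζ_j)) g_{n−j}⊗g_j + Σ_{α∈Φ₊} e_{−α} ∧ ( Σ_{k=1}^{p(α)} e_{τ^k(α)} ), where for α = (i,j) ∈ Φ₊ one sets p(α) = i−1 and τ^k(α) = (i−k, j−k). Then r is a skew-symmetric solution of the classical Yang–Baxter equation: for all pairwise distinct x₁,x₂,x₃ ∈ ℂ one has [r(x₁,x₂), r(x₁,x₃)]^{12,13} + [r(x₁,x₂), r(x₂,x₃)]^{12,23} + [r(x₁,x₃), r(x₂,x₃)]^{13,23} = 0, and r(x,y) = −σ(r(y,x)) for all x ≠ y. -/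
open scoped TensorProduct
open Matrix Finset

noncomputable section

/-- The Lie algebra of `n × n` complex matrices (ambient algebra of `𝔰𝔩ₙ(ℂ)`). -/
abbrev Mn (n : ℕ) : Type := Matrix (Fin n) (Fin n) ℂ

/-- The elementary matrix `e_{a,b}` (1-based indexing; zero if out of range). -/
def Eb (n : ℕ) (a b : ℕ) : Mn n :=
  Matrix.of fun p q : Fin n => if (p : ℕ) + 1 = a ∧ (q : ℕ) + 1 = b then (1 : ℂ) else 0

/-- `ζ_j = exp(2πij/n)`. -/
def ζ (n j : ℕ) : ℂ := Complex.exp (2 * Real.pi * Complex.I * j / n)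

/-- `g_j = diag(1, ζ_j, ζ_j², …, ζ_j^{n−1})`. -/
def gD (n j : ℕ) : Mn n := Matrix.diagonal fun p : Fin n => ζ n j ^ (p : ℕ)

/-- `a ∧ b = a⊗b − b⊗a`. -/
def wed {n : ℕ} (a b : Mn n) : Mn n ⊗[ℂ] Mn n := a ⊗ₜ[ℂ] b - b ⊗ₜ[ℂ] a

/-- The Casimir element `γ = Σ_{i≠j} e_{i,j}⊗e_{j,i} + (1/n) Σ_{j=1}^{n−1} g_{n−j}⊗g_j`
of the trace form on `𝔰𝔩ₙ(ℂ)`. -/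
def casimirN (n : ℕ) : Mn n ⊗[ℂ] Mn n :=
  (∑ i ∈ Icc 1 n, ∑ j ∈ Icc 1 n, if i ≠ j then Eb n i j ⊗ₜ[ℂ] Eb n j i else 0)
    + (n : ℂ)⁻¹ • ∑ j ∈ Icc 1 (n - 1), gD n (n - j) ⊗ₜ[ℂ] gD n j

/-- The constant part
`r₀ = (1/(2n)) Σ g_{n−j}⊗g_j + Σ_{α∈Φ₊} e_{−α}⊗e_α
  + (1/(2n)) Σ ((1+ζ_j)/(1−ζ_j)) g_{n−j}⊗g_j + Σ_{α∈Φ₊} e_{−α} ∧ (Σ_{k=1}^{p(α)} e_{τ^k(α)})`,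
where for `α = (i,j) ∈ Φ₊` one has `p(α) = i−1` and `τ^k(α) = (i−k, j−k)`. -/
def rNodal₀ (n : ℕ) : Mn n ⊗[ℂ] Mn n :=
  (1 / (2 * (n : ℂ))) • (∑ j ∈ Icc 1 (n - 1), gD n (n - j) ⊗ₜ[ℂ] gD n j)
    + (∑ i ∈ Icc 1 n, ∑ j ∈ Icc 1 n, if i < j then Eb n j i ⊗ₜ[ℂ] Eb n i j else 0)
    + (1 / (2 * (n : ℂ))) •
        (∑ j ∈ Icc 1 (n - 1), ((1 + ζ n j) / (1 - ζ n j)) • (gD n (n - j) ⊗ₜ[ℂ] gD n j))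
    + (∑ i ∈ Icc 1 n, ∑ j ∈ Icc 1 n,
        if i < j then wed (Eb n j i) (∑ k ∈ Icc 1 (i - 1), Eb n (i - k) (j - k)) else 0)

def cf2 {n : ℕ} (a b c d : Fin n) : Mn n ⊗[ℂ] Mn n →ₗ[ℂ] ℂ :=
  LinearMap.mul' ℂ ℂ ∘ₗ TensorProduct.map (Matrix.entryLinearMap ℂ ℂ a b) (Matrix.entryLinearMap ℂ ℂ c d)

def cf3 {n : ℕ} (a b c d e f : Fin n) : Mn n ⊗[ℂ] (Mn n ⊗[ℂ] Mn n) →ₗ[ℂ] ℂ :=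
  LinearMap.mul' ℂ ℂ ∘ₗ TensorProduct.map (Matrix.entryLinearMap ℂ ℂ a b) (cf2 c d e f)

lemma cf2_tmul {n : ℕ} (a b c d : Fin n) (x y : Mn n) :
    cf2 a b c d (x ⊗ₜ[ℂ] y) = x a b * y c d := by
  simp [cf2]

lemma cf3_tmul {n : ℕ} (a b c d e f : Fin n) (x y z : Mn n) :
    cf3 a b c d e f (x ⊗ₜ[ℂ] (y ⊗ₜ[ℂ] z)) = x a b * (y c d * z e f) := by
  simp [cf3, cf2]

lemma ext2 {n : ℕ} (X Y : Mn n ⊗[ℂ] Mn n) (h : ∀ a b c d, cf2 a b c d X = cf2 a b c d Y) : X = Y := by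
  let B := Matrix.stdBasis ℂ (Fin n) (Fin n)
  apply (B.tensorProduct B).ext_elem
  rintro ⟨⟨a, b⟩, ⟨c, d⟩⟩
  have key : ∀ X, (B.tensorProduct B).repr X ((a, b), (c, d)) = cf2 a b c d X := by
    intro X
    induction X with
    | zero => simp
    | add x y hx hy => simp [hx, hy]
    | tmul x y => simp [cf2_tmul, B, Matrix.stdBasis, Module.Basis.tensorProduct_repr_tmul_apply, mul_comm]
  rw [key, key, h]

lemma ext3 {n : ℕ} (X Y : Mn n ⊗[ℂ] (Mn n ⊗[ℂ] Mn n))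
    (h : ∀ a b c d e f, cf3 a b c d e f X = cf3 a b c d e f Y) : X = Y := by
  let B := Matrix.stdBasis ℂ (Fin n) (Fin n)
  apply (B.tensorProduct (B.tensorProduct B)).ext_elem
  rintro ⟨⟨a, b⟩, ⟨⟨c, d⟩, ⟨e, f⟩⟩⟩
  have key : ∀ X, (B.tensorProduct (B.tensorProduct B)).repr X ((a, b), ((c, d), (e, f))) = cf3 a b c d e f X := by
    intro X
    induction X with
    | zero => simp
    | add x y hx hy => simp [hx, hy]
    | tmul x y =>
      induction y with
      | zero => simp
      | add x y hx hy => simp [hx, hy, TensorProduct.tmul_add]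
      | tmul y z => simp [cf3_tmul, B, Matrix.stdBasis, Module.Basis.tensorProduct_repr_tmul_apply]; ring
  rw [key, key, h]

lemma cfB1 {n : ℕ} (B : (Mn n ⊗[ℂ] Mn n) →ₗ[ℂ] (Mn n ⊗[ℂ] Mn n) →ₗ[ℂ] (Mn n ⊗[ℂ] (Mn n ⊗[ℂ] Mn n)))
    (hB : ∀ a b c d : Mn n, B (a ⊗ₜ[ℂ] b) (c ⊗ₜ[ℂ] d) = ⁅a, c⁆ ⊗ₜ[ℂ] (b ⊗ₜ[ℂ] d))
    (X Y : Mn n ⊗[ℂ] Mn n) (a b c d e f : Fin n) :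
    cf3 a b c d e f (B X Y) = ∑ m, cf2 a m c d X * cf2 m b e f Y
      - ∑ m, cf2 m b c d X * cf2 a m e f Y := by
  induction X with
  | zero => simp
  | add x y hx hy => simp only [map_add, LinearMap.add_apply, hx, hy, add_mul, Finset.sum_add_distrib]; ring
  | tmul x y =>
    induction Y with
    | zero => simp
    | add x y hx hy => simp only [map_add, hx, hy, mul_add, Finset.sum_add_distrib]; ring
    | tmul z w =>
      simp only [hB, cf3_tmul, cf2_tmul, Ring.lie_def, Matrix.sub_apply, Matrix.mul_apply, sub_mul, Finset.sum_mul]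
      congr 1 <;> exact Finset.sum_congr rfl fun m _ => by ring

lemma cfB2 {n : ℕ} (B : (Mn n ⊗[ℂ] Mn n) →ₗ[ℂ] (Mn n ⊗[ℂ] Mn n) →ₗ[ℂ] (Mn n ⊗[ℂ] (Mn n ⊗[ℂ] Mn n)))
    (hB : ∀ a b c d : Mn n, B (a ⊗ₜ[ℂ] b) (c ⊗ₜ[ℂ] d) = a ⊗ₜ[ℂ] (⁅b, c⁆ ⊗ₜ[ℂ] d))
    (X Y : Mn n ⊗[ℂ] Mn n) (a b c d e f : Fin n) :
    cf3 a b c d e f (B X Y) = ∑ m, cf2 a b c m X * cf2 m d e f Y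
      - ∑ m, cf2 a b m d X * cf2 c m e f Y := by
  induction X with
  | zero => simp
  | add x y hx hy => simp only [map_add, LinearMap.add_apply, hx, hy, add_mul, Finset.sum_add_distrib]; ring
  | tmul x y =>
    induction Y with
    | zero => simp
    | add x y hx hy => simp only [map_add, hx, hy, mul_add, Finset.sum_add_distrib]; ring
    | tmul z w =>
      simp only [hB, cf3_tmul, cf2_tmul, Ring.lie_def, Matrix.sub_apply, Matrix.mul_apply, sub_mul, mul_sub, Finset.sum_mul, Finset.mul_sum]
      congr 1 <;> exact Finset.sum_congr rfl fun m _ => by ring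

lemma cfB3 {n : ℕ} (B : (Mn n ⊗[ℂ] Mn n) →ₗ[ℂ] (Mn n ⊗[ℂ] Mn n) →ₗ[ℂ] (Mn n ⊗[ℂ] (Mn n ⊗[ℂ] Mn n)))
    (hB : ∀ a b c d : Mn n, B (a ⊗ₜ[ℂ] b) (c ⊗ₜ[ℂ] d) = a ⊗ₜ[ℂ] (c ⊗ₜ[ℂ] ⁅b, d⁆))
    (X Y : Mn n ⊗[ℂ] Mn n) (a b c d e f : Fin n) :
    cf3 a b c d e f (B X Y) = ∑ m, cf2 a b e m X * cf2 c d m f Y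
      - ∑ m, cf2 a b m f X * cf2 c d e m Y := by
  induction X with
  | zero => simp
  | add x y hx hy => simp only [map_add, LinearMap.add_apply, hx, hy, add_mul, Finset.sum_add_distrib]; ring
  | tmul x y =>
    induction Y with
    | zero => simp
    | add x y hx hy => simp only [map_add, hx, hy, mul_add, Finset.sum_add_distrib]; ring
    | tmul z w =>
      simp only [hB, cf3_tmul, cf2_tmul, Ring.lie_def, Matrix.sub_apply, Matrix.mul_apply, sub_mul, mul_sub, Finset.sum_mul, Finset.mul_sum]
      congr 1 <;> exact Finset.sum_congr rfl fun m _ => by ring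

lemma cf2_comm {n : ℕ} (X : Mn n ⊗[ℂ] Mn n) (a b c d : Fin n) :
    cf2 a b c d (TensorProduct.comm ℂ (Mn n) (Mn n) X) = cf2 c d a b X := by
  induction X with
  | zero => simp
  | add x y hx hy => simp only [map_add, hx, hy]
  | tmul x y => simp [cf2_tmul, mul_comm]
def ph (f k h : ℂ) (a b c d : ℤ) : ℂ :=
  (if a = d then f else 0) + (if a = b then k + (c - a) * h else 0)
    + (if c ≤ b then 1 else 0) - (if a ≤ b then 1 else 0)

lemma ite_I (P : Prop) [Decidable P] (x : ℂ) : (if P then x else 0) = x * (if P then 1 else 0) := by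
  split_ifs <;> simp

/-- The part of the identity involving the Cartan terms. -/
lemma keyT (k1 k2 k3 h a b c d e f ab cd ef Lab Lcd Lcb Leb Led Gad Gcf Gaf Gcd Gef : ℂ)
    (hs : f = a + c + e - b - d)
    (z1 : ab * (a - b) = 0) (z2 : cd * (c - d) = 0) (z3 : ef * (e - f) = 0)
    (q1 : ab * Led = ab * Gcf) (q2 : cd * Leb = cd * Gaf) (q3 : ef * Gad = ef * Lcb)
    (q4 : ab * Lcd = ab * Gef) (q5 : cd * Lab = cd * Gef) (q6 : ef * Lab = ef * Gcd) :
    (k1 + (c - a) * h) * cd * ((k2 + (e - (a + c - d)) * h) * ef + Leb - Gef)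
    + (Gad - Gcd) * ((k2 + (e - (a + c - d)) * h) * ef)
    - (k1 + (c - (b + d - c)) * h) * cd * ((k2 + (e - a) * h) * ef + Gaf - Gef)
    - (Lcb - Gcd) * ((k2 + (e - a) * h) * ef)
    + (k1 + (c - a) * h) * ab * ((k3 + (e - (a + c - b)) * h) * ef + Led - Gef)
    + (Lcb - Lab) * ((k3 + (e - (a + c - b)) * h) * ef)
    - (k1 + (b + d - a - a) * h) * ab * ((k3 + (e - c) * h) * ef + Gcf - Gef)
    - (Gad - Lab) * ((k3 + (e - c) * h) * ef)
    + (k2 + (e - a) * h) * ab * ((k3 + (a + e - b - c) * h) * cd + Gcf - Lcd)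
    + (Leb - Lab) * ((k3 + (a + e - b - c) * h) * cd)
    - (k2 + (b + f - a - a) * h) * ab * ((k3 + (e - c) * h) * cd + Led - Lcd)
    - (Gaf - Lab) * ((k3 + (e - c) * h) * cd) = 0 := by
  grind

lemma key (f g p k1 k2 k3 h : ℂ) (hf : f * g - f * p + g * p + g = 0) (a b c d e f' : ℤ)
    (hs : f' = a + c + e - b - d) :
    ph f k1 h a (a+c-d) c d * ph g k2 h (a+c-d) b e f' - ph f k1 h (b+d-c) b c d * ph g k2 h a (b+d-c) e f'
    + (ph f k1 h a b c (a+c-b) * ph p k3 h (a+c-b) d e f' - ph f k1 h a b (b+d-a) d * ph p k3 h c (b+d-a) e f')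
    + (ph g k2 h a b e (a+e-b) * ph p k3 h c d (a+e-b) f' - ph g k2 h a b (b+f'-a) f' * ph p k3 h c d e (b+f'-a)) = 0 := by
  have h1 : (a = a + c - d ↔ c = d) := by omega
  have h2 : (c ≤ a + c - d ↔ d ≤ a) := by omega
  have h3 : (a ≤ a + c - d ↔ d ≤ c) := by omega
  have h4 : (a + c - d = f' ↔ b = e) := by omega
  have h5 : (a + c - d = b ↔ e = f') := by omega
  have h6 : (a + c - d ≤ b ↔ f' ≤ e) := by omega
  have h7 : (b + d - c = d ↔ b = c) := by omega
  have h8 : (b + d - c = b ↔ c = d) := by omega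
  have h9 : (b + d - c ≤ b ↔ d ≤ c) := by omega
  have h10 : (a = b + d - c ↔ e = f') := by omega
  have h11 : (e ≤ b + d - c ↔ f' ≤ a) := by omega
  have h12 : (a ≤ b + d - c ↔ f' ≤ e) := by omega
  have h13 : (a = a + c - b ↔ b = c) := by omega
  have h14 : (a + c - b = f' ↔ d = e) := by omega
  have h15 : (a + c - b = d ↔ e = f') := by omega
  have h16 : (a + c - b ≤ d ↔ f' ≤ e) := by omega
  have h17 : (b + d - a ≤ b ↔ d ≤ a) := by omega
  have h18 : (c = b + d - a ↔ e = f') := by omega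
  have h19 : (e ≤ b + d - a ↔ f' ≤ c) := by omega
  have h20 : (c ≤ b + d - a ↔ f' ≤ e) := by omega
  have h21 : (a = a + e - b ↔ b = e) := by omega
  have h22 : (a + e - b ≤ d ↔ f' ≤ c) := by omega
  have h23 : (b + f' - a ≤ b ↔ f' ≤ a) := by omega
  have h24 : (c = b + f' - a ↔ d = e) := by omega
  simp only [ph, h1, h2, h3, h4, h5, h6, h7, h8, h9, h10, h11, h12, h13, h14, h15, h16, h17, h18, h19, h20, h21, h22, h23, h24]
  clear h1 h2 h3 h4 h5 h6 h7 h8 h9 h10 h11 h12 h13 h14 h15 h16 h17 h18 h19 h20 h21 h22 h23 h24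
  have hsC : (f' : ℂ) = a + c + e - b - d := by rw [hs]; push_cast; ring
  obtain ⟨I, hI⟩ : ∃ I : Prop → ℂ, ∀ (P : Prop) [Decidable P], I P = if P then 1 else 0 := by
    classical
    exact ⟨fun P => if P then 1 else 0, fun P _ => by dsimp only; congr⟩
  have hIt : ∀ P : Prop, P → I P = 1 := fun P hP => by classical rw [hI, if_pos hP]
  have hIf : ∀ P : Prop, ¬ P → I P = 0 := fun P hP => by classical rw [hI, if_neg hP]
  have eqv : ∀ P Q R : Prop, (P → (Q ↔ R)) → I P * I Q = I P * I R := by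
    intro P Q R hPQ
    by_cases hP : P
    · rw [propext (hPQ hP)]
    · rw [hIf P hP]; ring
  have tri : ∀ P Q R : Prop, (P → (Q ∨ R)) → (Q → R → P) → I P * (I Q + I R - 1) = I Q * I R := by
    intro P Q R h1 h2
    by_cases hP : P <;> by_cases hQ : Q <;> by_cases hR : R <;>
      simp [hP, hQ, hR, hIt, hIf] <;> tauto
  have tri' : ∀ P Q R S : Prop, (P → (Q ∨ R)) → (P → (S ↔ (Q ∧ R))) →
      I P * (I Q + I R - 1) = I P * I S := by
    intro P Q R S h1 h2
    by_cases hP : P <;> by_cases hQ : Q <;> by_cases hR : R <;> by_cases hS : S <;>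
      simp [hP, hQ, hR, hS, hIt, hIf] <;> tauto
  have zz : ∀ x y : ℤ, I (x = y) * ((x : ℂ) - y) = 0 := by
    intro x y
    by_cases hP : x = y
    · rw [hP]; ring
    · rw [hIf _ hP]; ring
  have A1 := tri (e ≤ b) (d ≤ a) (f' ≤ c) (by omega) (by omega)
  have A2 := tri (f' ≤ a) (c ≤ b) (e ≤ d) (by omega) (by omega)
  have A3 := eqv (c = d) (f' ≤ a) (e ≤ b) (by omega)
  have A4 : I (d ≤ c) + I (c ≤ d) = 1 + I (c = d) := by
    rcases lt_trichotomy c d with h | h | h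
    · linear_combination hIf (d ≤ c) (by omega) + hIt (c ≤ d) (by omega) - hIf (c = d) (by omega)
    · linear_combination hIt (d ≤ c) (by omega) + hIt (c ≤ d) (by omega) - hIt (c = d) (by omega)
    · linear_combination hIt (d ≤ c) (by omega) + hIf (c ≤ d) (by omega) - hIf (c = d) (by omega)
  have F1 := eqv (a = d) (e ≤ b) (f' ≤ c) (by omega)
  have F2 := eqv (b = c) (e ≤ d) (f' ≤ a) (by omega)
  have F3 := eqv (e = f') (a = d) (b = c) (by omega)
  have G1 := tri' (b = e) (d ≤ a) (f' ≤ c) (a = d) (by omega) (by omega)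
  have G2 := tri' (a = f') (c ≤ b) (e ≤ d) (b = c) (by omega) (by omega)
  have G3 := eqv (c = d) (a = f') (b = e) (by omega)
  have P1 := eqv (d = e) (c ≤ b) (f' ≤ a) (by omega)
  have P2 := eqv (c = f') (e ≤ b) (d ≤ a) (by omega)
  have P3 := eqv (a = b) (d = e) (c = f') (by omega)
  have X1 := eqv (a = d) (b = e) (c = f') (by omega)
  have X2 := eqv (b = e) (a = d) (c = f') (by omega)
  have Y1 := eqv (b = c) (a = f') (d = e) (by omega)
  have Y2 := eqv (a = f') (b = c) (d = e) (by omega)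
  have HT := keyT k1 k2 k3 h a b c d e f' _ _ _ _ _ _ _ _ _ _ _ _ _ hsC (zz a b) (zz c d) (zz e f')
    (eqv (a = b) (e ≤ d) (f' ≤ c) (by omega)) (eqv (c = d) (e ≤ b) (f' ≤ a) (by omega))
    (eqv (e = f') (d ≤ a) (c ≤ b) (by omega)) (eqv (a = b) (c ≤ d) (f' ≤ e) (by omega))
    (eqv (c = d) (a ≤ b) (f' ≤ e) (by omega)) (eqv (e = f') (a ≤ b) (d ≤ c) (by omega))
  have Z1 := zz a d
  have Z2 := zz b c
  have Z3 := zz a b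
  have Z4 := zz c d
  have Z5 := zz e f'
  have Z6 := zz b e
  have Z7 := zz a f'
  have Z8 := zz d e
  have Z9 := zz c f'
  have cv : ∀ (P : Prop) [Decidable P] (x : ℂ), (if P then x else 0) = x * I P := by
    intro P _ x
    rw [hI]; split_ifs <;> simp
  simp only [cv, one_mul]
  push_cast
  generalize I (a = b) = Dab at *
  generalize I (a = d) = Dad at *
  generalize I (a = f') = Daf at *
  generalize I (b = c) = Dcb at *
  generalize I (c = d) = Dcd at *
  generalize I (c = f') = Dcf at *
  generalize I (b = e) = Deb at *
  generalize I (d = e) = Ded at *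
  generalize I (e = f') = Def at *
  generalize I (a ≤ b) = Lab at *
  generalize I (d ≤ a) = Gad at *
  generalize I (f' ≤ a) = Gaf at *
  generalize I (c ≤ b) = Lcb at *
  generalize I (c ≤ d) = Lcd at *
  generalize I (d ≤ c) = Gcd at *
  generalize I (f' ≤ c) = Gcf at *
  generalize I (e ≤ b) = Leb at *
  generalize I (e ≤ d) = Led at *
  generalize I (f' ≤ e) = Gef at *
  generalize (a : ℂ) = a at *
  generalize (b : ℂ) = b at *
  generalize (c : ℂ) = c at *
  generalize (d : ℂ) = d at *
  generalize (e : ℂ) = e at *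
  generalize (f' : ℂ) = f' at *
  clear eqv tri tri' zz cv hI hIt hIf
  subst hsC
  linear_combination (exp := 1) HT + A1 - A2 + hf * (Dad * Deb - Dcb * Daf) + A3 + (Gaf - Leb) * A4
    + f * F1 + f * F2 + f * (k2 - k3) * F3 + g * G1 - g * G2
    - f * h * Def * Z1 + f * h * Def * Z2 + f * p * X1 - f * p * Y1 - g * p * X2 + g * p * Y2
    - (k1 + k3) * g * G3 + (k1 - k2) * p * P3 - g * (Deb - Daf) * A4 + g * G3 + p * P1 + p * P2
    - h * g * Daf * Z4 - h * g * (e - b) * G3 + h * p * Dcf * Z3 + (d - e) * h * p * P3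


lemma ph_supp (f k h : ℂ) (a b c d : ℤ) (hs : a + c = b + d) (N : ℤ) (ha : 0 ≤ a) (hc : 0 ≤ c)
    (ha' : a < N) (hc' : c < N) (hb : ¬ (0 ≤ b ∧ b < N)) : ph f k h a b c d = 0 := by
  unfold ph
  rw [if_neg (by omega), if_neg (by omega)]
  split_ifs <;> first | omega | simp

lemma ph_supp' (f k h : ℂ) (a b c d : ℤ) (hs : a + c = b + d) (N : ℤ) (ha : 0 ≤ a) (hc : 0 ≤ c)
    (ha' : a < N) (hc' : c < N) (hb : ¬ (0 ≤ d ∧ d < N)) : ph f k h a b c d = 0 := by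
  unfold ph
  rw [if_neg (by omega), if_neg (by omega)]
  split_ifs <;> first | omega | simp

/-- Coefficients with the weight constraint. -/
def Ph (f k h : ℂ) (a b c d : ℤ) : ℂ := if a + c = b + d then ph f k h a b c d else 0

lemma sum_m {n : ℕ} (t : ℤ) (F : ℤ → ℂ) (h0 : ∀ m, m ≠ t → F m = 0)
    (h1 : ¬ (0 ≤ t ∧ t < n) → F t = 0) : ∑ m : Fin n, F ((m : ℕ) : ℤ) = F t := by
  by_cases ht : 0 ≤ t ∧ t < n
  · obtain ⟨s, rfl⟩ := Int.eq_ofNat_of_zero_le ht.1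
    have hs : s < n := by omega
    rw [Finset.sum_eq_single (⟨s, hs⟩ : Fin n)]
    · intro b _ hb
      apply h0
      intro h
      apply hb
      ext
      simp only
      omega
    · simp
  · rw [h1 ht]
    apply Finset.sum_eq_zero
    intro m _
    apply h0
    have := m.2
    omega

lemma key2 {n : ℕ} (f g p k1 k2 k3 h : ℂ) (hf : f * g - f * p + g * p + g = 0) (a b c d e f' : Fin n) :
    (∑ m : Fin n, Ph f k1 h a m c d * Ph g k2 h m b e f' - ∑ m : Fin n, Ph f k1 h m b c d * Ph g k2 h a m e f')
    + (∑ m : Fin n, Ph f k1 h a b c m * Ph p k3 h m d e f' - ∑ m : Fin n, Ph f k1 h a b m d * Ph p k3 h c m e f')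
    + (∑ m : Fin n, Ph g k2 h a b e m * Ph p k3 h c d m f' - ∑ m : Fin n, Ph g k2 h a b m f' * Ph p k3 h c d e m) = 0 := by
  have ha := a.2
  have hb := b.2
  have hc := c.2
  have hd := d.2
  have he := e.2
  have hf' := f'.2
  generalize hA : (((a : ℕ) : ℤ)) = A
  generalize hBB : (((b : ℕ) : ℤ)) = B
  generalize hC : (((c : ℕ) : ℤ)) = C
  generalize hD : (((d : ℕ) : ℤ)) = D
  generalize hE : (((e : ℕ) : ℤ)) = E
  generalize hF : (((f' : ℕ) : ℤ)) = F
  rw [sum_m (A + C - D) (fun m => Ph f k1 h A m C D * Ph g k2 h m B E F),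
    sum_m (A + E - F) (fun m => Ph f k1 h m B C D * Ph g k2 h A m E F),
    sum_m (A + C - B) (fun m => Ph f k1 h A B C m * Ph p k3 h m D E F),
    sum_m (C + E - F) (fun m => Ph f k1 h A B m D * Ph p k3 h C m E F),
    sum_m (A + E - B) (fun m => Ph g k2 h A B E m * Ph p k3 h C D m F),
    sum_m (C + E - D) (fun m => Ph g k2 h A B m F * Ph p k3 h C D E m)]
  · by_cases hs : A + C + E = B + D + F
    · have e1 : A + E - F = B + D - C := by omega
      have e2 : C + E - F = B + D - A := by omega
      have e3 : C + E - D = B + F - A := by omega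
      rw [e1, e2, e3]
      unfold Ph
      rw [if_pos (by omega), if_pos (by omega), if_pos (by omega), if_pos (by omega), if_pos (by omega),
        if_pos (by omega), if_pos (by omega), if_pos (by omega), if_pos (by omega), if_pos (by omega),
        if_pos (by omega), if_pos (by omega)]
      exact key f g p k1 k2 k3 h hf A B C D E F (by omega)
    · unfold Ph
      rw [if_neg (show ¬ (A + C - D + E = B + F) by omega), if_neg (show ¬ (A + E - F + C = B + D) by omega),
        if_neg (show ¬ (A + C - B + E = D + F) by omega), if_neg (show ¬ (A + (C + E - F) = B + D) by omega),
        if_neg (show ¬ (C + (A + E - B) = D + F) by omega), if_neg (show ¬ (A + (C + E - D) = B + F) by omega)]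
      ring
  · intro m hm
    simp only [Ph]; rw [if_neg (show ¬ (C + E = D + m) by omega)]; ring
  · intro ht
    simp only [Ph]; rw [ph_supp' p k3 h C D E _ (by omega) n (by omega) (by omega) (by omega) (by omega) ht]; simp
  · intro m hm
    simp only [Ph]; rw [if_neg (show ¬ (A + E = B + m) by omega)]; ring
  · intro ht
    simp only [Ph]; rw [ph_supp' g k2 h A B E _ (by omega) n (by omega) (by omega) (by omega) (by omega) ht]; simp
  · intro m hm
    simp only [Ph]; rw [if_neg (show ¬ (C + E = m + F) by omega)]; ring
  · intro ht
    simp only [Ph]; rw [ph_supp p k3 h C _ E F (by omega) n (by omega) (by omega) (by omega) (by omega) ht]; simp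
  · intro m hm
    simp only [Ph]; rw [if_neg (show ¬ (A + C = B + m) by omega)]; ring
  · intro ht
    simp only [Ph]; rw [ph_supp' f k1 h A B C _ (by omega) n (by omega) (by omega) (by omega) (by omega) ht]; simp
  · intro m hm
    simp only [Ph]; rw [if_neg (show ¬ (A + E = m + F) by omega)]; ring
  · intro ht
    simp only [Ph]; rw [ph_supp g k2 h A _ E F (by omega) n (by omega) (by omega) (by omega) (by omega) ht]; simp
  · intro m hm
    simp only [Ph]; rw [if_neg (show ¬ (A + C = m + D) by omega)]; ring
  · intro ht
    simp only [Ph]; rw [ph_supp f k1 h A _ C D (by omega) n (by omega) (by omega) (by omega) (by omega) ht]; simp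

lemma skew (f f' k k' h : ℂ) (hf : f + f' = -1) (hk : k + k' = 1) (a b c d : ℤ) :
    Ph f k h a b c d = - Ph f' k' h c d a b := by
  unfold Ph
  by_cases hs : a + c = b + d
  · rw [if_pos hs, if_pos (by omega)]
    unfold ph
    have h1 : (c = b ↔ a = d) := by omega
    have h2 : (c = d ↔ a = b) := by omega
    have h3 : (a ≤ d ↔ b ≤ c) := by omega
    have h4 : (c ≤ d ↔ b ≤ a) := by omega
    simp only [h1, h2, h3, h4]
    split_ifs <;> first | omega | linear_combination hf + hk | linear_combination hf | linear_combination hk | ring1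
  · rw [if_neg hs, if_neg (by omega)]; ring

lemma zeta_prim (n : ℕ) (hn : 2 ≤ n) : IsPrimitiveRoot (ζ n 1) n := by
  have := Complex.isPrimitiveRoot_exp n (by omega)
  unfold ζ
  simpa using this

lemma zeta_pow (n j : ℕ) : ζ n j = ζ n 1 ^ j := by
  unfold ζ
  rw [← Complex.exp_nat_mul]
  congr 1
  push_cast
  ring

lemma zeta_ne (n : ℕ) (hn : 2 ≤ n) (j : ℕ) (hj : j ∈ Icc 1 (n - 1)) : ζ n j ≠ 1 := by
  rw [Finset.mem_Icc] at hj
  rw [zeta_pow]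
  exact (zeta_prim n hn).pow_ne_one_of_pos_of_lt (by omega) (by omega)

lemma zeta_ne0 (n j : ℕ) : ζ n j ≠ 0 := Complex.exp_ne_zero _

lemma zeta_inv (n : ℕ) (hn : 2 ≤ n) (j : ℕ) (hj : j ∈ Icc 1 (n - 1)) : ζ n (n - j) = (ζ n j)⁻¹ := by
  rw [Finset.mem_Icc] at hj
  apply eq_inv_of_mul_eq_one_left
  rw [zeta_pow n j, zeta_pow n (n - j), ← pow_add,
    Nat.sub_add_cancel (by omega), (zeta_prim n hn).pow_eq_one]

lemma sum_zeta (n : ℕ) (hn : 2 ≤ n) (m : ℤ) (h1 : -n < m) (h2 : m < n) :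
    ∑ j ∈ Icc 1 (n - 1), ζ n j ^ m = (if m = 0 then (n : ℂ) else 0) - 1 := by
  have e : ∑ j ∈ range n, (ζ n 1 ^ m) ^ j = 1 + ∑ j ∈ Icc 1 (n - 1), ζ n j ^ m := by
    have : range n = insert 0 (Icc 1 (n - 1)) := by
      ext x; simp only [Finset.mem_range, Finset.mem_insert, Finset.mem_Icc]; omega
    rw [this, Finset.sum_insert (by simp)]
    rw [pow_zero]
    congr 1
    apply Finset.sum_congr rfl
    intro j _
    rw [zeta_pow n j, ← zpow_natCast, ← zpow_natCast, ← _root_.zpow_mul, ← _root_.zpow_mul, mul_comm]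
  have e2 : ∑ j ∈ range n, (ζ n 1 ^ m) ^ j = if m = 0 then (n : ℂ) else 0 := by
    split_ifs with hm
    · simp [hm]
    · have hne : ζ n 1 ^ m ≠ 1 := by
        intro h
        rw [(zeta_prim n hn).zpow_eq_one_iff_dvd] at h
        apply hm
        apply Int.eq_zero_of_abs_lt_dvd h
        rw [abs_lt]; exact ⟨h1, h2⟩
      rw [geom_sum_eq hne, ← zpow_natCast, ← _root_.zpow_mul, mul_comm, _root_.zpow_mul, zpow_natCast,
        (zeta_prim n hn).pow_eq_one]
      simp
  rw [← e2, e]; ring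

/-- The weighted root of unity sum. -/
def DD (n : ℕ) (m : ℤ) : ℂ := ∑ j ∈ Icc 1 (n - 1), (1 - ζ n j)⁻¹ * ζ n j ^ m

lemma DD_step (n : ℕ) (hn : 2 ≤ n) (m : ℤ) (h1 : -n < m) (h2 : m < n) :
    DD n m - DD n (m + 1) = (if m = 0 then (n : ℂ) else 0) - 1 := by
  rw [← sum_zeta n hn m h1 h2, DD, DD, ← Finset.sum_sub_distrib]
  apply Finset.sum_congr rfl
  intro j hj
  have := zeta_ne n hn j hj
  have h : 1 - ζ n j ≠ 0 := sub_ne_zero.2 (Ne.symm this)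
  rw [zpow_add_one₀ (zeta_ne0 n j)]
  field_simp

lemma DD_zero (n : ℕ) (hn : 2 ≤ n) : DD n 0 = (n - 1) / 2 := by
  have e : DD n 0 = ∑ j ∈ Icc 1 (n - 1), (1 - (ζ n j)⁻¹)⁻¹ := by
    rw [DD]
    apply Finset.sum_bij' (fun j _ => n - j) (fun j _ => n - j)
    · intro j hj; rw [Finset.mem_Icc] at *; omega
    · intro j hj; rw [Finset.mem_Icc] at *; omega
    · intro j hj; rw [Finset.mem_Icc] at *; omega
    · intro j hj; rw [Finset.mem_Icc] at *; omega
    · intro j hj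
      rw [zeta_inv n hn j hj]; simp
  have e2 : DD n 0 + DD n 0 = n - 1 := by
    nth_rewrite 2 [e]
    rw [DD, ← Finset.sum_add_distrib]
    have : ∀ j ∈ Icc 1 (n - 1), (1 - ζ n j)⁻¹ * ζ n j ^ (0 : ℤ) + (1 - (ζ n j)⁻¹)⁻¹ = 1 := by
      intro j hj
      have h0 := zeta_ne0 n j
      have h1 : 1 - ζ n j ≠ 0 := sub_ne_zero.2 (Ne.symm (zeta_ne n hn j hj))
      have h2 : ζ n j - 1 ≠ 0 := sub_ne_zero.2 (zeta_ne n hn j hj)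
      have h3 : 1 - (ζ n j)⁻¹ = - (1 - ζ n j) / ζ n j := by field_simp; ring
      rw [h3]
      field_simp
      ring
    rw [Finset.sum_congr rfl this]
    simp only [sum_const, Nat.card_Icc, nsmul_eq_mul, mul_one]
    rw [Nat.cast_sub (by omega)]
    push_cast [Nat.cast_sub (show 1 ≤ n by omega)]
    simp
    try rw [Nat.cast_sub (by omega)]
    try simp
  linear_combination e2 / 2

lemma DD_nonneg (n : ℕ) (hn : 2 ≤ n) (m : ℕ) (h : m < n) :
    DD n m = (n - 1) / 2 + m - (if 0 < m then (n : ℂ) else 0) := by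
  induction m with
  | zero => simp [DD_zero n hn]
  | succ m ih =>
    have h1 := ih (by omega)
    have h2 := DD_step n hn m (by omega) (by omega)
    push_cast
    rw [if_pos (by omega)]
    by_cases hm : m = 0
    · subst hm
      simp at h1 h2 ⊢
      linear_combination h1 - h2
    · rw [if_pos (by omega)] at h1
      rw [if_neg (by omega)] at h2
      linear_combination h1 - h2

lemma DD_neg (n : ℕ) (hn : 2 ≤ n) (m : ℕ) (h : m < n) :
    DD n (-m) = (n - 1) / 2 - m := by
  induction m with
  | zero => simp [DD_zero n hn]
  | succ m ih =>
    have h1 := ih (by omega)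
    have h2 := DD_step n hn (-((m + 1 : ℕ) : ℤ)) (by omega) (by omega)
    rw [if_neg (by omega)] at h2
    have h3 : (-((m + 1 : ℕ) : ℤ)) + 1 = - (m : ℤ) := by push_cast; ring
    rw [h3] at h2
    push_cast at *
    linear_combination h1 + h2

lemma DD_eq (n : ℕ) (hn : 2 ≤ n) (a c : Fin n) :
    DD n ((c : ℕ) - (a : ℕ) : ℤ) = (n - 1) / 2 + ((c : ℕ) - (a : ℕ)) - (if (a : ℕ) < c then (n : ℂ) else 0) := by
  have ha := a.2
  have hc := c.2
  by_cases h : (a : ℕ) ≤ c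
  · obtain ⟨s, hs⟩ := Nat.exists_eq_add_of_le h
    have e : ((c : ℕ) - (a : ℕ) : ℤ) = (s : ℕ) := by omega
    rw [e, DD_nonneg n hn s (by omega), hs]
    push_cast
    by_cases h0 : 0 < s
    · rw [if_pos h0, if_pos (by omega)]; ring
    · rw [if_neg h0, if_neg (by omega)]; ring
  · obtain ⟨s, hs⟩ := Nat.exists_eq_add_of_le (show (c : ℕ) ≤ a by omega)
    have e : ((c : ℕ) - (a : ℕ) : ℤ) = -(s : ℕ) := by omega
    rw [e, DD_neg n hn s (by omega), if_neg (show ¬ (a : ℕ) < c by omega), hs]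
    push_cast
    ring

lemma cf_gD (n : ℕ) (hn : 2 ≤ n) (j : ℕ) (hj : j ∈ Icc 1 (n - 1)) (a b c d : Fin n) :
    cf2 a b c d (gD n (n - j) ⊗ₜ[ℂ] gD n j) =
      if a = b ∧ c = d then ζ n j ^ ((c : ℕ) - (a : ℕ) : ℤ) else 0 := by
  rw [cf2_tmul, gD, gD, zeta_inv n hn j hj, Matrix.diagonal_apply, Matrix.diagonal_apply,
    zpow_sub₀ (zeta_ne0 n j), zpow_natCast, zpow_natCast]
  by_cases h1 : a = b <;> by_cases h2 : c = d <;> simp [h1, h2]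
  rw [div_eq_mul_inv, mul_comm]

lemma dsum (n : ℕ) (i0 j0 : Fin n) (G : ℕ → ℕ → ℂ)
    (h : ∀ i j, ¬ (i = (i0 : ℕ) + 1 ∧ j = (j0 : ℕ) + 1) → G i j = 0) :
    ∑ i ∈ Icc 1 n, ∑ j ∈ Icc 1 n, G i j = G (i0 + 1) (j0 + 1) := by
  have hi := i0.2
  have hj := j0.2
  rw [Finset.sum_eq_single ((i0 : ℕ) + 1), Finset.sum_eq_single ((j0 : ℕ) + 1)]
  · intro j _ hj; exact h _ _ (by omega)
  · intro h'; exact absurd (Finset.mem_Icc.2 ⟨by omega, by omega⟩) h'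
  · intro i _ hi; exact Finset.sum_eq_zero fun j _ => h _ _ (by omega)
  · intro h'; exact absurd (Finset.mem_Icc.2 ⟨by omega, by omega⟩) h'

lemma cf_cas (n : ℕ) (hn : 2 ≤ n) (a b c d : Fin n) :
    cf2 a b c d (casimirN n) = (if (a : ℕ) ≠ b ∧ (a : ℕ) = d ∧ (b : ℕ) = c then 1 else 0)
      + (n : ℂ)⁻¹ * (if (a : ℕ) = b ∧ (c : ℕ) = d then (if (a : ℕ) = c then (n : ℂ) else 0) - 1 else 0) := by
  have ha := a.2
  have hc := c.2
  rw [casimirN, map_add, map_smul, map_sum, map_sum, Finset.sum_congr rfl fun j hj => cf_gD n hn j hj a b c d]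
  congr 1
  · simp only [map_sum]
    rw [dsum n a b]
    · rw [apply_ite (cf2 a b c d), cf2_tmul, map_zero]
      simp only [Eb, Matrix.of_apply]
      simp only [and_self, if_true, one_mul]
      split_ifs <;> first | omega | rfl
    · intro i j hij
      rw [apply_ite (cf2 a b c d), cf2_tmul, map_zero]
      simp only [Eb, Matrix.of_apply]
      rw [if_neg (show ¬ ((a : ℕ) + 1 = i ∧ (b : ℕ) + 1 = j) by omega)]
      simp
  · rw [smul_eq_mul]
    congr 1
    have e : (a = b ∧ c = d) ↔ ((a : ℕ) = b ∧ (c : ℕ) = d) := by rw [Fin.ext_iff, Fin.ext_iff]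
    simp only [e]
    by_cases h : ((a : ℕ) = b ∧ (c : ℕ) = d)
    · simp only [if_pos h]
      rw [sum_zeta n hn _ (by omega) (by omega)]
      congr 1
      split_ifs <;> first | omega | rfl
    · simp [if_neg h]

lemma ksum (a b : ℕ) (hb : b < a) (p q : ℕ) :
    ∑ k ∈ Icc 1 b, (if p + 1 = b + 1 - k ∧ q + 1 = a + 1 - k then (1 : ℂ) else 0)
     = if p < b ∧ a + p = b + q then 1 else 0 := by
  by_cases h : p < b ∧ a + p = b + q
  · rw [Finset.sum_eq_single (b - p), if_pos (by omega), if_pos h]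
    · intro k hk hne
      rw [if_neg (by omega)]
    · intro h'; exact absurd (Finset.mem_Icc.2 ⟨by omega, by omega⟩) h'
  · rw [if_neg h]
    apply Finset.sum_eq_zero
    intro k hk
    rw [Finset.mem_Icc] at hk
    rw [if_neg (by omega)]

lemma cf_r0 (n : ℕ) (hn : 2 ≤ n) (a b c d : Fin n) :
    cf2 a b c d (rNodal₀ n) =
      (n : ℂ)⁻¹ * (if (a : ℕ) = b ∧ (c : ℕ) = d then
        (n - 1) / 2 + ((c : ℕ) - (a : ℕ)) - (if (a : ℕ) < c then (n : ℂ) else 0) else 0)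
      + (if (b : ℕ) < a ∧ (a : ℕ) = d ∧ (b : ℕ) = c then 1 else 0)
      + ((if (b : ℕ) < a ∧ (c : ℕ) < b ∧ (a : ℕ) + c = b + d then 1 else 0)
      - (if (d : ℕ) < c ∧ (a : ℕ) < d ∧ (a : ℕ) + c = b + d then 1 else 0)) := by
  have ha := a.2
  have hc := c.2
  have hn0 : (n : ℂ) ≠ 0 := by exact_mod_cast (by omega : n ≠ 0)
  have S1 : cf2 a b c d ((1 / (2 * (n : ℂ))) • (∑ j ∈ Icc 1 (n - 1), gD n (n - j) ⊗ₜ[ℂ] gD n j))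
     + cf2 a b c d ((1 / (2 * (n : ℂ))) •
        (∑ j ∈ Icc 1 (n - 1), ((1 + ζ n j) / (1 - ζ n j)) • (gD n (n - j) ⊗ₜ[ℂ] gD n j)))
      = (n : ℂ)⁻¹ * (if (a : ℕ) = b ∧ (c : ℕ) = d then
        (n - 1) / 2 + ((c : ℕ) - (a : ℕ)) - (if (a : ℕ) < c then (n : ℂ) else 0) else 0) := by
    rw [← DD_eq n hn a c, DD]
    simp only [map_smul, map_sum, smul_eq_mul]
    rw [← mul_add, ← Finset.sum_add_distrib]
    have e : (a = b ∧ c = d) ↔ ((a : ℕ) = b ∧ (c : ℕ) = d) := by rw [Fin.ext_iff, Fin.ext_iff]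
    by_cases h : ((a : ℕ) = b ∧ (c : ℕ) = d)
    · rw [if_pos h, Finset.mul_sum, Finset.mul_sum]
      apply Finset.sum_congr rfl
      intro j hj
      rw [cf_gD n hn j hj, if_pos (e.2 h)]
      have h1 : 1 - ζ n j ≠ 0 := sub_ne_zero.2 (Ne.symm (zeta_ne n hn j hj))
      field_simp
      ring
    · rw [if_neg h, mul_zero, Finset.sum_eq_zero, mul_zero]
      intro j hj
      rw [cf_gD n hn j hj, if_neg (fun h' => h (e.1 h'))]
      simp
  have S2 : cf2 a b c d (∑ i ∈ Icc 1 n, ∑ j ∈ Icc 1 n, if i < j then Eb n j i ⊗ₜ[ℂ] Eb n i j else 0)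
      = (if (b : ℕ) < a ∧ (a : ℕ) = d ∧ (b : ℕ) = c then 1 else 0) := by
    simp only [map_sum]
    rw [dsum n b a]
    · rw [apply_ite (cf2 a b c d), cf2_tmul, map_zero]
      simp only [Eb, Matrix.of_apply]
      simp only [and_self, if_true, one_mul]
      split_ifs <;> first | omega | rfl
    · intro i j hij
      rw [apply_ite (cf2 a b c d), cf2_tmul, map_zero]
      simp only [Eb, Matrix.of_apply]
      rw [if_neg (show ¬ ((a : ℕ) + 1 = j ∧ (b : ℕ) + 1 = i) by omega)]
      simp
  have S3 : cf2 a b c d (∑ i ∈ Icc 1 n, ∑ j ∈ Icc 1 n,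
        if i < j then wed (Eb n j i) (∑ k ∈ Icc 1 (i - 1), Eb n (i - k) (j - k)) else 0)
      = ((if (b : ℕ) < a ∧ (c : ℕ) < b ∧ (a : ℕ) + c = b + d then 1 else 0)
      - (if (d : ℕ) < c ∧ (a : ℕ) < d ∧ (a : ℕ) + c = b + d then 1 else 0)) := by
    have e : ∀ i j : ℕ, cf2 a b c d (if i < j then wed (Eb n j i) (∑ k ∈ Icc 1 (i - 1), Eb n (i - k) (j - k)) else 0)
      = (if i < j then (if (a : ℕ) + 1 = j ∧ (b : ℕ) + 1 = i then 1 else 0) *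
          ∑ k ∈ Icc 1 (i - 1), (if (c : ℕ) + 1 = i - k ∧ (d : ℕ) + 1 = j - k then (1 : ℂ) else 0) else 0)
        - (if i < j then (∑ k ∈ Icc 1 (i - 1), (if (a : ℕ) + 1 = i - k ∧ (b : ℕ) + 1 = j - k then (1 : ℂ) else 0)) *
          (if (c : ℕ) + 1 = j ∧ (d : ℕ) + 1 = i then 1 else 0) else 0) := by
      intro i j
      split_ifs <;> simp [wed, cf2_tmul, Eb, Matrix.sum_apply, *]
    simp only [map_sum, e, Finset.sum_sub_distrib]
    rw [dsum n b a, dsum n d c]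
    · congr 1
      · by_cases h : (b : ℕ) < a
        · rw [if_pos (by omega), Nat.add_sub_cancel, ksum a b h]
          simp [h]
        · rw [if_neg (by omega), if_neg (by omega)]
      · by_cases h : (d : ℕ) < c
        · rw [if_pos (by omega), Nat.add_sub_cancel, ksum c d h]
          simp only [h, true_and, and_self, if_true, mul_one]
          split_ifs <;> first | omega | rfl
        · rw [if_neg (by omega), if_neg (by omega)]
    · intro i j hij
      rw [if_neg (show ¬ ((c : ℕ) + 1 = j ∧ (d : ℕ) + 1 = i) by omega)]
      simp
    · intro i j hij
      rw [if_neg (show ¬ ((a : ℕ) + 1 = j ∧ (b : ℕ) + 1 = i) by omega)]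
      simp
  rw [rNodal₀, map_add, map_add, map_add, S2, S3, ← S1]
  ring

set_option maxHeartbeats 1000000 in
lemma cf_r (n : ℕ) (hn : 2 ≤ n) (f : ℂ) (a b c d : Fin n) :
    cf2 a b c d (f • casimirN n + rNodal₀ n)
      = Ph f ((n - 1) / 2 * (n : ℂ)⁻¹ - f * (n : ℂ)⁻¹) (n : ℂ)⁻¹ a b c d := by
  have hn0 : (n : ℂ) * (n : ℂ)⁻¹ = 1 := mul_inv_cancel₀ (by exact_mod_cast (by omega : n ≠ 0))
  rw [map_add, map_smul, cf_cas n hn, cf_r0 n hn, smul_eq_mul]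
  unfold Ph ph
  have e0 : ((a : ℕ) : ℤ) + ((c : ℕ) : ℤ) = ((b : ℕ) : ℤ) + ((d : ℕ) : ℤ) ↔ (a : ℕ) + c = b + d := by omega
  have e1 : ((c : ℕ) : ℤ) ≤ ((b : ℕ) : ℤ) ↔ (c : ℕ) ≤ b := by omega
  have e2 : ((a : ℕ) : ℤ) ≤ ((b : ℕ) : ℤ) ↔ (a : ℕ) ≤ b := by omega
  have e3 : ((a : ℕ) : ℤ) = ((b : ℕ) : ℤ) ↔ (a : ℕ) = b := by omega
  have e4 : ((a : ℕ) : ℤ) = ((d : ℕ) : ℤ) ↔ (a : ℕ) = d := by omega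
  simp only [e0, e1, e2, e3, e4, Int.cast_natCast]
  clear e0 e1 e2 e3 e4
  generalize (a : ℕ) = a at *
  generalize (b : ℕ) = b at *
  generalize (c : ℕ) = c at *
  generalize (d : ℕ) = d at *
  by_cases hs : a + c = b + d
  · by_cases h1 : a = b
    · have h2 : c = d := by omega
      subst h1 h2
      simp only [ne_eq, not_true_eq_false, false_and, lt_irrefl, if_false, if_true, and_self, le_refl]
      rcases lt_trichotomy a c with h | h | h
      · rw [if_neg (show ¬ a = c by omega), if_pos h, if_neg (show ¬ a = c by omega), if_neg (show ¬ c ≤ a by omega)]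
        linear_combination -hn0
      · subst h
        simp only [lt_irrefl, if_false, if_true, le_refl]
        linear_combination f * hn0
      · rw [if_neg (show ¬ a = c by omega), if_neg (show ¬ a < c by omega), if_neg (show ¬ a = c by omega), if_pos (show c ≤ a by omega)]
        ring
    · have h3 : (b = c) ↔ (a = d) := by omega
      have h4 : (d < c) ↔ (a < b) := by omega
      simp only [h1, h3, h4, hs, ne_eq, not_false_eq_true, true_and, false_and, and_true, if_false, if_true, and_self]
      split_ifs <;> first | omega | ring1
  · have h1 : ¬ (a = b ∧ c = d) := by omega
    have h2 : ¬ (a = d ∧ b = c) := by omega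
    simp only [hs, h1, h2, and_false, if_false]
    ring

/-- For `𝔤 = 𝔰𝔩ₙ(ℂ)`, `n ≥ 2`, the function
`r(x,y) = (x/(y−x))·γ + r₀` is a skew-symmetric solution of the classical Yang–Baxter
equation. -/
theorem statement5
    (n : ℕ) (hn : 2 ≤ n)
    (B1213 B1223 B1323 :
      (Mn n ⊗[ℂ] Mn n) →ₗ[ℂ] (Mn n ⊗[ℂ] Mn n) →ₗ[ℂ] (Mn n ⊗[ℂ] (Mn n ⊗[ℂ] Mn n)))
    (hB1213 : ∀ a b c d : Mn n,
      B1213 (a ⊗ₜ[ℂ] b) (c ⊗ₜ[ℂ] d) = ⁅a, c⁆ ⊗ₜ[ℂ] (b ⊗ₜ[ℂ] d))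
    (hB1223 : ∀ a b c d : Mn n,
      B1223 (a ⊗ₜ[ℂ] b) (c ⊗ₜ[ℂ] d) = a ⊗ₜ[ℂ] (⁅b, c⁆ ⊗ₜ[ℂ] d))
    (hB1323 : ∀ a b c d : Mn n,
      B1323 (a ⊗ₜ[ℂ] b) (c ⊗ₜ[ℂ] d) = a ⊗ₜ[ℂ] (c ⊗ₜ[ℂ] ⁅b, d⁆))
    (r : ℂ → ℂ → Mn n ⊗[ℂ] Mn n)
    (hr : ∀ x y : ℂ, r x y = (x / (y - x)) • casimirN n + rNodal₀ n) :
    (∀ x₁ x₂ x₃ : ℂ, x₁ ≠ x₂ → x₁ ≠ x₃ → x₂ ≠ x₃ →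
        B1213 (r x₁ x₂) (r x₁ x₃) + B1223 (r x₁ x₂) (r x₂ x₃)
          + B1323 (r x₁ x₃) (r x₂ x₃) = 0)
      ∧ (∀ x y : ℂ, x ≠ y →
          r x y = - (TensorProduct.comm ℂ (Mn n) (Mn n) (r y x))) := by
  have hfun : ∀ x y : ℂ, ∀ a b c d : Fin n, cf2 a b c d (r x y) =
      Ph (x / (y - x)) ((n - 1) / 2 * (n : ℂ)⁻¹ - x / (y - x) * (n : ℂ)⁻¹) (n : ℂ)⁻¹ a b c d := by
    intro x y a b c d
    rw [hr, cf_r n hn]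
  have hn0 : (n : ℂ) * (n : ℂ)⁻¹ = 1 := mul_inv_cancel₀ (by exact_mod_cast (by omega : n ≠ 0))
  constructor
  · intro x y z hxy hxz hyz
    have h1 : y - x ≠ 0 := sub_ne_zero.2 hxy.symm
    have h2 : z - x ≠ 0 := sub_ne_zero.2 hxz.symm
    have h3 : z - y ≠ 0 := sub_ne_zero.2 hyz.symm
    apply ext3
    intro a b c d e f
    rw [map_add, map_add, cfB1 B1213 hB1213, cfB2 B1223 hB1223, cfB3 B1323 hB1323, map_zero]
    simp only [hfun]
    apply key2
    field_simp
    ring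
  · intro x y hxy
    have h1 : y - x ≠ 0 := sub_ne_zero.2 hxy.symm
    have h2 : x - y ≠ 0 := sub_ne_zero.2 hxy
    have hf : x / (y - x) + y / (x - y) = -1 := by
      rw [← neg_sub y x]
      field_simp
      ring
    apply ext2
    intro a b c d
    rw [map_neg, cf2_comm, hfun, hfun]
    apply skew _ _ _ _ _ hf
    linear_combination hn0 - (n : ℂ)⁻¹ * hf


end
end

section
/- Let 𝔤 = 𝔰𝔩_n(ℂ), n ≥ 2, with the notation below. Define r(x,y) = (1/(y−x))·γ + Σ_{k=1}^{n−1} h_k* ∧ e_{k+1,k} + Σ_{(k,l): k ≥ l+2} ( Σ_{j=0}^{l−1} e_{l−j, k−j−1} ) ∧ e_{k,l}, where the last sum runs over pairs 1 ≤ l ≤ n−2, l+2 ≤ k ≤ n. Then r is a skew-symmetric solution of the classical Yang–Baxter equation: for all pairwise distinct x₁,x₂,x₃ ∈ ℂ one has [r(x₁,x₂), r(x₁,x₃)]^{12,13} + [r(x₁,x₂), r(x₂,x₃)]^{12,23} + [r(x₁,x₃), r(x₂,x₃)]^{13,23} = 0, and r(x,y) = −σ(r(y,x)) for all x ≠ y.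 -/
open scoped TensorProduct
open Matrix Finset

noncomputable section

/-- `h_k*`: the diagonal matrix whose first `k` diagonal entries equal `(n−k)/n` and whose
last `n−k` diagonal entries equal `−k/n` (dual basis of `(h_1,…,h_{n−1})` for the trace
form). -/
def hStar (n k : ℕ) : Mn n :=
  Matrix.diagonal fun p : Fin n =>
    if (p : ℕ) + 1 ≤ k then ((n : ℂ) - k) / n else -((k : ℂ) / n)

/-- The constant part
`Σ_{k=1}^{n−1} h_k* ∧ e_{k+1,k} + Σ_{1 ≤ l ≤ n−2, l+2 ≤ k ≤ n} (Σ_{j=0}^{l−1} e_{l−j,k−j−1}) ∧ e_{k,l}`. -/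
def rCusp₀ (n : ℕ) : Mn n ⊗[ℂ] Mn n :=
  (∑ k ∈ Icc 1 (n - 1), wed (hStar n k) (Eb n (k + 1) k))
    + ∑ l ∈ Icc 1 (n - 2), ∑ k ∈ Icc (l + 2) n,
        wed (∑ j ∈ Finset.range l, Eb n (l - j) (k - j - 1)) (Eb n k l)


/-- extension by zero -/
def ex {n : ℕ} (α : Mn n) (p q : ℕ) : ℂ :=
  if h : p < n ∧ q < n then α ⟨p, h.1⟩ ⟨q, h.2⟩ else 0

lemma ex_fin {n : ℕ} (α : Mn n) (p q : Fin n) : ex α p q = α p q := by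
  simp [ex]

lemma ex_out {n : ℕ} (α : Mn n) (p q : ℕ) (h : ¬ (p < n ∧ q < n)) : ex α p q = 0 := by
  simp [ex, h]

/-- upper sum -/
def Us {n : ℕ} (α : Mn n) (p q : ℕ) : ℂ := ∑ j ∈ range (n - q), ex α (p + j) (q + j)

/-- lower sum -/
def Ls {n : ℕ} (α : Mn n) (p q : ℕ) : ℂ := ∑ j ∈ range q, ex α (p - 1 - j) (q - 1 - j)

lemma Us_rec {n : ℕ} (α : Mn n) (p q : ℕ) (h : q < n) :
    Us α p q = ex α p q + Us α (p + 1) (q + 1) := by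
  unfold Us
  obtain ⟨m, hm⟩ : ∃ m, n - q = m + 1 := ⟨n - q - 1, by omega⟩
  have hm' : n - (q + 1) = m := by omega
  rw [hm, hm', Finset.sum_range_succ', add_comm]
  congr 1
  apply Finset.sum_congr rfl
  intro j _
  congr 1 <;> omega

lemma Us_out {n : ℕ} (α : Mn n) (p q : ℕ) (h : n ≤ q) : Us α p q = 0 := by
  unfold Us
  rw [Nat.sub_eq_zero_of_le h]; simp

lemma Ls_rec {n : ℕ} (α : Mn n) (p q : ℕ) :
    Ls α (p + 1) (q + 1) = ex α p q + Ls α p q := by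
  unfold Ls
  rw [Finset.sum_range_succ', add_comm]
  congr 1
  apply Finset.sum_congr rfl
  intro j _
  congr 1 <;> omega

lemma Ls_zero {n : ℕ} (α : Mn n) (p : ℕ) : Ls α p 0 = 0 := by simp [Ls]

/-- the operator on gl -/
def Rp {n : ℕ} (α : Mn n) : Mn n :=
  Matrix.of fun p q : Fin n =>
    if (p : ℕ) ≤ q then Us α p (q + 1) else - Ls α p (q + 1)

/-- principal nilpotent -/
def Fn (n : ℕ) : Mn n := Matrix.of fun p q : Fin n => if (p : ℕ) + 1 = q then 1 else 0

lemma mulF {n : ℕ} (u : Mn n) (p q : Fin n) :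
    (u * Fn n) p q = if (q : ℕ) = 0 then 0 else ex u p (q - 1) := by
  rw [Matrix.mul_apply]
  by_cases h : (q : ℕ) = 0
  · rw [if_pos h]
    apply Finset.sum_eq_zero
    intro s _
    simp [Fn, h]
  · rw [if_neg h]
    have hq := q.2
    rw [Finset.sum_eq_single (⟨(q : ℕ) - 1, by omega⟩ : Fin n)]
    · have : (q : ℕ) - 1 < n := by omega
      simp [Fn, ex, this]
      intro h2; omega
    · intro s _ hs
      have : ¬ ((s : ℕ) + 1 = q) := by
        intro h2; apply hs; ext; simp; omega
      simp [Fn, this]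
    · simp

lemma Fmul {n : ℕ} (u : Mn n) (p q : Fin n) :
    (Fn n * u) p q = ex u (p + 1) q := by
  rw [Matrix.mul_apply]
  by_cases h : (p : ℕ) + 1 < n
  · rw [Finset.sum_eq_single (⟨(p : ℕ) + 1, h⟩ : Fin n)]
    · simp [Fn, ex, h]
    · intro s _ hs
      have : ¬ ((p : ℕ) + 1 = s) := by
        intro h2; apply hs; ext; simp; omega
      simp [Fn, this]
    · simp
  · rw [ex_out _ _ _ (by omega)]
    apply Finset.sum_eq_zero
    intro s _
    have : ¬ ((p : ℕ) + 1 = s) := by have := s.2; omega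
    simp [Fn, this]

lemma brF {n : ℕ} (u : Mn n) (p q : ℕ) (hp : p < n) (hq : q < n) :
    ex ⁅u, Fn n⁆ p q = (if q = 0 then 0 else ex u p (q - 1)) - ex u (p + 1) q := by
  have h1 : ex ⁅u, Fn n⁆ p q = ⁅u, Fn n⁆ ⟨p, hp⟩ ⟨q, hq⟩ := by simp [ex, hp, hq]
  rw [h1, Ring.lie_def, Matrix.sub_apply, mulF, Fmul]

/-- parabolic -/
def inQ {n : ℕ} (u : Mn n) : Prop := ∀ p q : Fin n, (q : ℕ) + 1 = n → p ≠ q → u p q = 0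
/-- its annihilator -/
def inK {n : ℕ} (u : Mn n) : Prop := ∀ p q : Fin n, ((p : ℕ) + 1 < n ∨ (q : ℕ) + 1 = n) → u p q = 0

lemma inQ.mul {n : ℕ} {u v : Mn n} (hu : inQ u) (hv : inQ v) : inQ (u * v) := by
  intro p q hq hpq
  rw [Matrix.mul_apply]
  apply Finset.sum_eq_zero
  intro s _
  by_cases h : s = q
  · rw [h, hu p q hq hpq, zero_mul]
  · rw [hv s q hq h, mul_zero]

lemma inQ.lie {n : ℕ} {u v : Mn n} (hu : inQ u) (hv : inQ v) : inQ ⁅u, v⁆ := by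
  intro p q hq hpq
  rw [Ring.lie_def, Matrix.sub_apply, hu.mul hv p q hq hpq, hv.mul hu p q hq hpq, sub_zero]

lemma inK.lie {n : ℕ} {u v : Mn n} (hu : inQ u) (hv : inK v) : inK ⁅u, v⁆ := by
  intro p q h
  rw [Ring.lie_def, Matrix.sub_apply, Matrix.mul_apply, Matrix.mul_apply,
    Finset.sum_eq_zero, Finset.sum_eq_zero, sub_zero]
  · intro s _
    rcases h with h | h
    · rw [hv p s (Or.inl h), zero_mul]
    · by_cases hs : s = q
      · rw [hs, hv p q (Or.inr h), zero_mul]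
      · rw [hu s q h hs, mul_zero]
  · intro s _
    rcases h with h | h
    · by_cases hs : (s : ℕ) + 1 < n
      · rw [hv s q (Or.inl hs), mul_zero]
      · rw [hu p s (by have := s.2; omega) (by rintro rfl; omega), zero_mul]
    · rw [hv s q (Or.inr h), mul_zero]

lemma Rp_inQ {n : ℕ} (α : Mn n) : inQ (Rp α) := by
  intro p q hq hpq
  have h1 : (p : ℕ) ≤ q := by have := p.2; omega
  simp only [Rp, Matrix.of_apply, if_pos h1]
  exact Us_out _ _ _ (by omega)

lemma Rp_K {n : ℕ} {ν : Mn n} (h : inK ν) : Rp ν = 0 := by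
  ext p q
  have hp := p.2
  have hq := q.2
  simp only [Rp, Matrix.of_apply, Matrix.zero_apply]
  split_ifs with h1
  · apply Finset.sum_eq_zero
    intro j hj
    rw [Finset.mem_range] at hj
    unfold ex
    split_ifs with h2
    · exact h _ _ (Or.inl (by simp only; omega))
    · rfl
  · rw [neg_eq_zero]
    apply Finset.sum_eq_zero
    intro j hj
    rw [Finset.mem_range] at hj
    unfold ex
    split_ifs with h2
    · exact h _ _ (Or.inl (by simp only; omega))
    · rfl

lemma Us_brF {n : ℕ} {u : Mn n} (hu : inQ u) (m : ℕ) : ∀ p q : ℕ, p ≤ q → q + 1 + m = n →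
    Us ⁅u, Fn n⁆ p (q + 1) = ex u p q - if p = q then ex u (n - 1) (n - 1) else 0 := by
  induction m with
  | zero =>
    intro p q h1 h2
    rw [Us_out _ _ _ (by omega)]
    have : q = n - 1 := by omega
    subst this
    split_ifs with h
    · subst h; simp
    · rw [sub_zero]
      unfold ex
      rw [dif_pos (by omega)]
      exact (hu _ _ (by simp only; omega) (by simpa using h)).symm
  | succ m ih =>
    intro p q h1 h2
    rw [Us_rec _ _ _ (by omega), ih (p + 1) (q + 1) (by omega) (by omega),
      brF _ _ _ (by omega) (by omega)]
    simp

lemma Ls_brF {n : ℕ} {u : Mn n} (q : ℕ) : ∀ p : ℕ, q < p → p < n →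
    Ls ⁅u, Fn n⁆ p (q + 1) = - ex u p q := by
  induction q with
  | zero =>
    intro p h1 h2
    obtain ⟨p, rfl⟩ : ∃ m, p = m + 1 := ⟨p - 1, by omega⟩
    rw [Ls_rec, Ls_zero, brF _ _ _ (by omega) (by omega)]
    simp
  | succ q ih =>
    intro p h1 h2
    obtain ⟨p, rfl⟩ : ∃ m, p = m + 1 := ⟨p - 1, by omega⟩
    rw [Ls_rec, ih p (by omega) (by omega), brF _ _ _ (by omega) (by omega)]
    simp
    ring

lemma Rp_brF {n : ℕ} {u : Mn n} (hu : inQ u) :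
    Rp ⁅u, Fn n⁆ = u - ex u (n - 1) (n - 1) • (1 : Mn n) := by
  ext p q
  have hp := p.2
  have hq := q.2
  simp only [Rp, Matrix.of_apply, Matrix.sub_apply, Matrix.smul_apply, Matrix.one_apply, smul_eq_mul]
  split_ifs with h1 h2 h2
  · rw [Us_brF hu (n - (q + 1)) p q h1 (by omega), ex_fin, if_pos (by rw [h2]), mul_one]
  · rw [Us_brF hu (n - (q + 1)) p q h1 (by omega), ex_fin, if_neg (by simpa [Fin.ext_iff] using h2), mul_zero]
  · exfalso; apply h1; rw [h2]
  · rw [Ls_brF _ _ (by omega) hp, ex_fin]; simp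

lemma Ls_trace {n : ℕ} (α : Mn n) (m : ℕ) : Ls α m m = ∑ j ∈ range m, ex α j j := by
  induction m with
  | zero => simp [Ls]
  | succ m ih => rw [Ls_rec, ih, Finset.sum_range_succ, add_comm]

lemma trace_ex {n : ℕ} (α : Mn n) : Matrix.trace α = ∑ j ∈ range n, ex α j j := by
  rw [Matrix.trace, ← Fin.sum_univ_eq_sum_range (fun j => ex α j j)]
  simp [ex_fin]

lemma ex_Rp {n : ℕ} (α : Mn n) (p q : ℕ) (hp : p < n) (hq : q < n) :
    ex (Rp α) p q = if p ≤ q then Us α p (q + 1) else - Ls α p (q + 1) := by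
  simp [ex, hp, hq, Rp]

lemma Rp_solve {n : ℕ} {α : Mn n} (hα : Matrix.trace α = 0) : inK (α - ⁅Rp α, Fn n⁆) := by
  intro p q h
  have hp := p.2
  have hq := q.2
  rw [Matrix.sub_apply, ← ex_fin α p q, ← ex_fin ⁅Rp α, Fn n⁆ p q, brF _ _ _ hp hq]
  by_cases hpn : (p : ℕ) + 1 < n
  · rw [ex_Rp _ _ _ hpn hq]
    by_cases hpq : (p : ℕ) < q
    · obtain ⟨q', hq'⟩ : ∃ m, (q : ℕ) = m + 1 := ⟨q - 1, by omega⟩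
      rw [if_neg (by omega), ex_Rp _ _ _ hp (by omega), if_pos (by omega), if_pos (by omega)]
      rw [Nat.sub_add_cancel (by omega), Us_rec _ _ _ hq]
      ring
    · rw [if_neg (by omega : ¬ (p : ℕ) + 1 ≤ q), Ls_rec]
      split_ifs with h0
      · rw [h0, Ls_zero]; ring
      · rw [ex_Rp _ _ _ hp (by omega), if_neg (by omega), Nat.sub_add_cancel (by omega)]; ring
  · have hqn : (q : ℕ) + 1 = n := by omega
    have hpq : (p : ℕ) = q := by omega
    rw [ex_out _ ((p : ℕ) + 1) _ (by omega), hpq]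
    have hr : range n = range ((q : ℕ) + 1) := by rw [hqn]
    rw [trace_ex, hr, Finset.sum_range_succ] at hα
    split_ifs with h0
    · rw [h0] at hα ⊢; simpa using hα
    · rw [ex_Rp _ _ _ (by omega) (by omega), if_neg (by omega), Nat.sub_add_cancel (by omega),
        Ls_trace]
      linear_combination hα

/-- trace pairing -/
def phi {n : ℕ} (α : Mn n) : Mn n →ₗ[ℂ] ℂ :=
  (Matrix.traceLinearMap (Fin n) ℂ ℂ) ∘ₗ LinearMap.mulRight ℂ α

lemma phi_apply {n : ℕ} (α b : Mn n) : phi α b = Matrix.trace (b * α) := rfl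

/-- contraction of second leg -/
def ct {n : ℕ} (α : Mn n) : Mn n ⊗[ℂ] Mn n →ₗ[ℂ] Mn n :=
  (TensorProduct.rid ℂ (Mn n)).toLinearMap ∘ₗ LinearMap.lTensor (Mn n) (phi α)

lemma ct_tmul {n : ℕ} (α a b : Mn n) : ct α (a ⊗ₜ[ℂ] b) = phi α b • a := by
  simp [ct]

lemma ct_wed {n : ℕ} (α a b : Mn n) : ct α (wed a b) = phi α b • a - phi α a • b := by
  simp [wed, ct_tmul]

lemma phi_Eb {n : ℕ} (α : Mn n) (a b : ℕ) : phi α (Eb n (a + 1) (b + 1)) = ex α b a := by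
  rw [phi_apply]
  simp only [Matrix.trace, Matrix.diag, Matrix.mul_apply, Eb, Matrix.of_apply, add_left_inj]
  by_cases h : b < n ∧ a < n
  · rw [Finset.sum_eq_single ⟨a, h.2⟩, Finset.sum_eq_single ⟨b, h.1⟩]
    · simp [ex, h]
    · intro s _ hs
      have : (s : ℕ) ≠ b := fun h2 => hs (Fin.ext h2)
      simp [this]
    · simp
    · intro s _ hs
      have : (s : ℕ) ≠ a := fun h2 => hs (Fin.ext h2)
      simp [this]
    · simp
  · rw [ex_out _ _ _ h]
    apply Finset.sum_eq_zero; intro s _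
    apply Finset.sum_eq_zero; intro t _
    have := s.2
    have := t.2
    rw [if_neg (by omega), zero_mul]

lemma phi_Eb' {n : ℕ} (α : Mn n) (a b : ℕ) (ha : 1 ≤ a) (hb : 1 ≤ b) :
    phi α (Eb n a b) = ex α (b - 1) (a - 1) := by
  rw [← phi_Eb, Nat.sub_add_cancel ha, Nat.sub_add_cancel hb]

lemma phi_hStar {n : ℕ} (α : Mn n) (hα : Matrix.trace α = 0) (k : ℕ) (hk : k ≤ n) (hn : n ≠ 0) :
    phi α (hStar n k) = ∑ j ∈ range k, ex α j j := by
  rw [phi_apply, hStar, Matrix.trace]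
  simp only [Matrix.diag, Matrix.diagonal_mul]
  have h0 : (n : ℂ) ≠ 0 := by exact_mod_cast hn
  have h1 : ∀ x : Fin n, (if (x : ℕ) + 1 ≤ k then ((n : ℂ) - k) / n else -((k : ℂ) / n)) * α x x
      = (if (x : ℕ) < k then ex α x x else 0) - (k / n) * α x x := by
    intro x
    rw [ex_fin]
    by_cases h : (x : ℕ) < k
    · rw [if_pos h, if_pos (by omega)]; field_simp
    · rw [if_neg h, if_neg (by omega)]; ring
  rw [Finset.sum_congr rfl (fun x _ => h1 x), Finset.sum_sub_distrib, ← Finset.mul_sum]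
  have h2 : ∑ i, α i i = 0 := hα
  rw [h2, mul_zero, sub_zero, Fin.sum_univ_eq_sum_range (fun j => if j < k then ex α j j else 0),
    ← Finset.sum_filter]
  congr 1
  ext x
  simp; omega

lemma sumEb {n : ℕ} (p q : Fin n) (l k : ℕ) (hk : l + 2 ≤ k) :
    (∑ j ∈ Finset.range l, Eb n (l - j) (k - j - 1)) p q =
      if (p : ℕ) < l ∧ k + p = q + 1 + l then 1 else 0 := by
  rw [Matrix.sum_apply]
  simp only [Eb, Matrix.of_apply]
  split_ifs with h
  · rw [Finset.sum_eq_single (l - p - 1)]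
    · rw [if_pos (by omega)]
    · intro j hj hne
      rw [Finset.mem_range] at hj
      rw [if_neg (by omega)]
    · intro hh
      rw [Finset.mem_range] at hh
      omega
  · apply Finset.sum_eq_zero
    intro j hj
    rw [Finset.mem_range] at hj
    rw [if_neg (by omega)]

lemma sum_shift {n : ℕ} (α : Mn n) (p q N : ℕ) (hpq : p ≤ q) (hN : N = n - 1 ∨ (N = n - 2 ∧ p < q)) :
    ∑ l ∈ Icc 1 N, (if p < l ∧ l + q + 1 - p ≤ n then ex α (l - 1) (l + q - p) else 0)
      = Us α p (q + 1) := by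
  rw [← Finset.sum_filter, Us]
  refine Finset.sum_bij' (fun l _ => l - p - 1) (fun j _ => p + 1 + j) ?_ ?_ ?_ ?_ ?_
  · intro l hl; simp at hl ⊢; omega
  · intro l hl; simp at hl ⊢; omega
  · intro l hl; simp at hl ⊢; omega
  · intro l hl; simp at hl ⊢; omega
  · intro l hl; simp at hl ⊢; congr 1 <;> omega

lemma ct_r0 {n : ℕ} (hn : 2 ≤ n) (α : Mn n) (hα : Matrix.trace α = 0) :
    ∃ c : ℂ, ct α (rCusp₀ n) = Rp α - c • (1 : Mn n) := by
  refine ⟨∑ k ∈ Icc 1 (n - 1), (k / n : ℂ) * ex α (k - 1) k, ?_⟩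
  have h0 : (n : ℂ) ≠ 0 := by exact_mod_cast (by omega : n ≠ 0)
  ext p q
  have hp := p.2
  have hq := q.2
  have E1 : ct α (rCusp₀ n) p q =
      (∑ k ∈ Icc 1 (n - 1), (ex α (k - 1) k * hStar n k p q
          - phi α (hStar n k) * Eb n (k + 1) k p q))
      + ∑ l ∈ Icc 1 (n - 2), ∑ k ∈ Icc (l + 2) n,
        (ex α (l - 1) (k - 1) * (if (p : ℕ) < l ∧ k + p = q + 1 + l then 1 else 0)
          - (∑ j ∈ range l, ex α (k - j - 2) (l - j - 1)) * Eb n k l p q) := by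
    simp only [rCusp₀, map_add, map_sum, ct_wed, Matrix.add_apply, Matrix.sum_apply,
      Matrix.sub_apply, Matrix.smul_apply, smul_eq_mul]
    congr 1
    · apply Finset.sum_congr rfl
      intro k hk
      rw [Finset.mem_Icc] at hk
      rw [phi_Eb' _ _ _ (by omega) (by omega)]
      simp
    · apply Finset.sum_congr rfl
      intro l hl
      apply Finset.sum_congr rfl
      intro k hk
      rw [Finset.mem_Icc] at hk hl
      rw [phi_Eb' _ _ _ (by omega) (by omega), ← Matrix.sum_apply, sumEb p q l k hk.1]
      congr 2
      apply Finset.sum_congr rfl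
      intro j hj
      rw [Finset.mem_range] at hj
      rw [phi_Eb' _ _ _ (by omega) (by omega)]
      congr 1
  rw [E1, Matrix.sub_apply, Matrix.smul_apply, Matrix.one_apply, smul_eq_mul]
  simp only [Rp, Matrix.of_apply]
  rcases lt_trichotomy (p : ℕ) (q : ℕ) with h | h | h
  · have hne : p ≠ q := by rintro rfl; omega
    rw [if_pos h.le, if_neg hne, mul_zero, sub_zero, Finset.sum_eq_zero, zero_add]
    · rw [← sum_shift α p q (n - 2) h.le (Or.inr ⟨rfl, h⟩)]
      apply Finset.sum_congr rfl
      intro l hl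
      rw [Finset.mem_Icc] at hl
      have hE : ∀ k ∈ Icc (l + 2) n, Eb n k l p q = 0 := by
        intro k hk
        rw [Finset.mem_Icc] at hk
        simp only [Eb, Matrix.of_apply]
        rw [if_neg (by omega)]
      rw [Finset.sum_congr rfl (fun k hk => by rw [hE k hk, mul_zero, sub_zero])]
      split_ifs with h2
      · rw [Finset.sum_eq_single (l + q + 1 - p)]
        · rw [if_pos (by omega), mul_one]; congr 1; omega
        · intro k _ hk
          rw [if_neg (by omega), mul_zero]
        · intro hh
          rw [Finset.mem_Icc] at hh
          omega
      · apply Finset.sum_eq_zero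
        intro k hk
        rw [Finset.mem_Icc] at hk
        rw [if_neg (by omega), mul_zero]
    · intro k hk
      simp only [Eb, Matrix.of_apply, hStar]
      rw [Matrix.diagonal_apply_ne _ hne, if_neg (by omega)]
      ring
  · have hpq : p = q := Fin.ext h
    subst hpq
    rw [if_pos le_rfl, if_pos rfl, mul_one, ← sum_shift α p p (n - 1) le_rfl (Or.inl rfl),
      ← Finset.sum_sub_distrib]
    conv_lhs => arg 2; rw [Finset.sum_eq_zero (fun l hl => Finset.sum_eq_zero (fun k hk => by
      rw [Finset.mem_Icc] at hk
      simp only [Eb, Matrix.of_apply]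
      rw [if_neg (by omega), if_neg (by omega)]
      ring))]
    rw [add_zero]
    apply Finset.sum_congr rfl
    intro k hk
    rw [Finset.mem_Icc] at hk
    simp only [Eb, Matrix.of_apply, hStar, Matrix.diagonal_apply_eq]
    have e1 : k + (p : ℕ) - p = k := by omega
    rw [e1, if_neg (by omega : ¬ ((p : ℕ) + 1 = k + 1 ∧ (p : ℕ) + 1 = k))]
    by_cases h2 : (p : ℕ) < k
    · rw [if_pos (by omega), if_pos (by omega)]
      field_simp
      ring
    · rw [if_neg (by omega), if_neg (by omega)]
      ring
  · have hne : p ≠ q := by rintro rfl; omega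
    rw [if_neg (by omega), if_neg hne, mul_zero, sub_zero]
    have hS : ∀ k l : ℕ, l + 2 ≤ k → ¬ ((p : ℕ) < l ∧ k + p = q + 1 + l) := by
      intro k l hk; omega
    by_cases h1 : (p : ℕ) = q + 1
    · rw [Finset.sum_eq_single ((q : ℕ) + 1)]
      · conv_lhs => arg 2; rw [Finset.sum_eq_zero (fun l hl => Finset.sum_eq_zero (fun k hk => by
          rw [Finset.mem_Icc] at hk
          simp only [Eb, Matrix.of_apply]
          rw [if_neg (by omega), if_neg (by omega)]
          ring))]
        have hd : hStar n ((q : ℕ) + 1) p q = 0 := by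
          simp only [hStar, Matrix.diagonal_apply_ne _ hne]
        have he : Eb n ((q : ℕ) + 1 + 1) ((q : ℕ) + 1) p q = 1 := by
          simp [Eb, h1]
        rw [hd, he, phi_hStar α hα _ (by omega) (by omega), ← Ls_trace, h1]
        ring
      · intro k hk hkq
        simp only [Eb, Matrix.of_apply, hStar, Matrix.diagonal_apply_ne _ hne]
        rw [if_neg (by omega)]
        ring
      · intro hh
        rw [Finset.mem_Icc] at hh
        omega
    · rw [Finset.sum_eq_zero, zero_add]
      · rw [Finset.sum_eq_single ((q : ℕ) + 1), Finset.sum_eq_single ((p : ℕ) + 1)]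
        · have he : Eb n ((p : ℕ) + 1) ((q : ℕ) + 1) p q = 1 := by
            simp [Eb]
          rw [if_neg (by omega), he, Ls, mul_zero, mul_one, zero_sub]
          congr 1
          apply Finset.sum_congr rfl
          intro j hj
          congr 1 <;> omega
        · intro k hk hkq
          rw [Finset.mem_Icc] at hk
          simp only [Eb, Matrix.of_apply]
          rw [if_neg (by omega), if_neg (by omega)]
          ring
        · intro hh
          rw [Finset.mem_Icc] at hh
          omega
        · intro l hl hlq
          apply Finset.sum_eq_zero
          intro k hk
          rw [Finset.mem_Icc] at hk
          simp only [Eb, Matrix.of_apply]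
          rw [if_neg (by omega), if_neg (by omega)]
          ring
        · intro hh
          rw [Finset.mem_Icc] at hh
          omega
      · intro k hk
        simp only [Eb, Matrix.of_apply, hStar, Matrix.diagonal_apply_ne _ hne]
        rw [if_neg (by omega)]
        ring

lemma x_add_lie {n : ℕ} (a b c : Mn n) : ⁅a + b, c⁆ = ⁅a, c⁆ + ⁅b, c⁆ := by
  simp only [Ring.lie_def, add_mul, mul_add]; abel
lemma x_lie_add {n : ℕ} (a b c : Mn n) : ⁅c, a + b⁆ = ⁅c, a⁆ + ⁅c, b⁆ := by
  simp only [Ring.lie_def, add_mul, mul_add]; abel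
lemma x_sub_lie {n : ℕ} (a b c : Mn n) : ⁅a - b, c⁆ = ⁅a, c⁆ - ⁅b, c⁆ := by
  simp only [Ring.lie_def, sub_mul, mul_sub]; abel
lemma x_lie_sub {n : ℕ} (a b c : Mn n) : ⁅c, a - b⁆ = ⁅c, a⁆ - ⁅c, b⁆ := by
  simp only [Ring.lie_def, sub_mul, mul_sub]; abel
lemma x_smul_lie {n : ℕ} (t : ℂ) (a c : Mn n) : ⁅t • a, c⁆ = t • ⁅a, c⁆ := by
  simp only [Ring.lie_def, smul_mul_assoc, mul_smul_comm, smul_sub]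
lemma x_lie_smul {n : ℕ} (t : ℂ) (a c : Mn n) : ⁅a, t • c⁆ = t • ⁅a, c⁆ := by
  simp only [Ring.lie_def, smul_mul_assoc, mul_smul_comm, smul_sub]
lemma x_lie_skew {n : ℕ} (a c : Mn n) : -⁅c, a⁆ = ⁅a, c⁆ := by
  simp only [Ring.lie_def, neg_sub]
lemma x_zero_lie {n : ℕ} (c : Mn n) : ⁅(0 : Mn n), c⁆ = 0 := by
  simp [Ring.lie_def]
lemma x_lie_zero {n : ℕ} (c : Mn n) : ⁅c, (0 : Mn n)⁆ = 0 := by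
  simp [Ring.lie_def]

lemma phi_add {n : ℕ} (α β : Mn n) : phi (α + β) = phi α + phi β := by
  ext1 b; simp [phi_apply, mul_add]

lemma phi_smul {n : ℕ} (c : ℂ) (α : Mn n) : phi (c • α) = c • phi α := by
  ext1 b; simp [phi_apply]

lemma ct_add {n : ℕ} (α β : Mn n) (t : Mn n ⊗[ℂ] Mn n) : ct (α + β) t = ct α t + ct β t := by
  simp [ct, phi_add, LinearMap.lTensor_add]

lemma ct_smul {n : ℕ} (c : ℂ) (α : Mn n) (t : Mn n ⊗[ℂ] Mn n) : ct (c • α) t = c • ct α t := by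
  simp [ct, phi_smul, LinearMap.lTensor_smul]

lemma ct_neg {n : ℕ} (α : Mn n) (t : Mn n ⊗[ℂ] Mn n) : ct (-α) t = - ct α t := by
  rw [← neg_one_smul ℂ α, ct_smul, neg_one_smul]

lemma ct_sub {n : ℕ} (α β : Mn n) (t : Mn n ⊗[ℂ] Mn n) : ct (α - β) t = ct α t - ct β t := by
  rw [sub_eq_add_neg, ct_add, ct_neg, sub_eq_add_neg]

lemma trace_ct {n : ℕ} (α : Mn n) (t : Mn n ⊗[ℂ] Mn n) :
    Matrix.trace (ct α t) = Matrix.trace (ct 1 (TensorProduct.comm ℂ _ _ t) * α) := by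
  induction t using TensorProduct.induction_on with
  | zero => simp
  | tmul a b => simp [ct_tmul, phi_apply, mul_comm]
  | add x y hx hy => simp [hx, hy, add_mul]

lemma comm_wed {n : ℕ} (a b : Mn n) : TensorProduct.comm ℂ (Mn n) (Mn n) (wed a b) = - wed a b := by
  simp [wed]

lemma comm_r0 (n : ℕ) : TensorProduct.comm ℂ (Mn n) (Mn n) (rCusp₀ n) = - rCusp₀ n := by
  simp only [rCusp₀, map_add, map_sum, comm_wed, Finset.sum_neg_distrib]
  abel

lemma phi_one_Eb {n : ℕ} (a b : ℕ) (h : a ≠ b) : phi 1 (Eb n a b) = 0 := by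
  rw [phi_apply, mul_one, Matrix.trace]
  apply Finset.sum_eq_zero
  intro s _
  simp only [Matrix.diag, Eb, Matrix.of_apply]
  rw [if_neg (by omega)]

lemma phi_one_hStar {n : ℕ} (k : ℕ) (hk : k ≤ n) (hn : n ≠ 0) : phi 1 (hStar n k) = 0 := by
  rw [phi_apply, mul_one, hStar, Matrix.trace]
  simp only [Matrix.diag, Matrix.diagonal_apply_eq]
  have h0 : (n : ℂ) ≠ 0 := by exact_mod_cast hn
  have h1 : ∀ x : Fin n, (if (x : ℕ) + 1 ≤ k then ((n : ℂ) - k) / n else -((k : ℂ) / n))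
      = (if (x : ℕ) < k then 1 else 0) - (k / n) := by
    intro x
    by_cases h : (x : ℕ) < k
    · rw [if_pos h, if_pos (by omega)]; field_simp
    · rw [if_neg h, if_neg (by omega)]; ring
  rw [Finset.sum_congr rfl (fun x _ => h1 x), Finset.sum_sub_distrib,
    Fin.sum_univ_eq_sum_range (fun j => if j < k then (1 : ℂ) else 0), ← Finset.sum_filter]
  have : (range n).filter (fun j => j < k) = range k := by ext x; simp; omega
  rw [this]
  simp
  field_simp
  ring

lemma ct_one_r0 {n : ℕ} : ct 1 (rCusp₀ n) = 0 := by
  simp only [rCusp₀, map_add, map_sum, ct_wed]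
  rw [Finset.sum_eq_zero, Finset.sum_eq_zero, add_zero]
  · intro l hl
    apply Finset.sum_eq_zero
    intro k hk
    rw [Finset.mem_Icc] at hk hl
    have hz : ∑ j ∈ range l, phi (n := n) 1 (Eb n (l - j) (k - j - 1)) = 0 := by
      apply Finset.sum_eq_zero
      intro j hj
      rw [Finset.mem_range] at hj
      exact phi_one_Eb _ _ (by omega)
    rw [phi_one_Eb _ _ (by omega), hz]
    simp
  · intro k hk
    rw [Finset.mem_Icc] at hk
    rw [phi_one_Eb _ _ (by omega), phi_one_hStar _ (by omega) (by omega)]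
    simp

lemma trace_r0 {n : ℕ} (α : Mn n) : Matrix.trace (ct α (rCusp₀ n)) = 0 := by
  rw [trace_ct, comm_r0, map_neg, ct_one_r0]; simp

lemma trace_br {n : ℕ} (u v : Mn n) : Matrix.trace ⁅u, v⁆ = 0 := by
  rw [Ring.lie_def, Matrix.trace_sub, Matrix.trace_mul_comm, sub_self]

lemma one_lie' {n : ℕ} (u : Mn n) : ⁅(1 : Mn n), u⁆ = 0 := by simp [Ring.lie_def]
lemma lie_one' {n : ℕ} (u : Mn n) : ⁅u, (1 : Mn n)⁆ = 0 := by simp [Ring.lie_def]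

lemma smul_one_unique {n : ℕ} (hn : 2 ≤ n) (c : ℂ) (h : Matrix.trace (c • (1 : Mn n)) = 0) :
    c = 0 := by
  have h0 : (n : ℂ) ≠ 0 := by exact_mod_cast (by omega : n ≠ 0)
  simpa [h0] using h

lemma R_brF {n : ℕ} (hn : 2 ≤ n) {u : Mn n} (hu : inQ u) (ht : Matrix.trace u = 0) :
    ct ⁅u, Fn n⁆ (rCusp₀ n) = u := by
  obtain ⟨c, hc⟩ := ct_r0 hn ⁅u, Fn n⁆ (trace_br _ _)
  have h2 := trace_r0 ⁅u, Fn n⁆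
  rw [Rp_brF hu, sub_sub, ← add_smul] at hc
  rw [hc, Matrix.trace_sub, ht, zero_sub, neg_eq_zero] at h2
  rw [hc, smul_one_unique hn _ h2]; simp

lemma R_K {n : ℕ} (hn : 2 ≤ n) {ν : Mn n} (h : inK ν) (ht : Matrix.trace ν = 0) :
    ct ν (rCusp₀ n) = 0 := by
  obtain ⟨c, hc⟩ := ct_r0 hn ν ht
  have h2 := trace_r0 ν
  rw [Rp_K h] at hc
  rw [hc, Matrix.trace_sub, Matrix.trace_zero, zero_sub, neg_eq_zero] at h2
  rw [hc, smul_one_unique hn _ h2]; simp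

lemma R_decomp {n : ℕ} (hn : 2 ≤ n) (α : Mn n) : ∃ ν : Mn n, ∃ c : ℂ, inK ν ∧
    inQ (ct α (rCusp₀ n)) ∧ α = ⁅ct α (rCusp₀ n), Fn n⁆ + ν + c • (1 : Mn n) := by
  have h0 : (n : ℂ) ≠ 0 := by exact_mod_cast (by omega : n ≠ 0)
  set c : ℂ := Matrix.trace α / n
  have ht : Matrix.trace (α - c • (1 : Mn n)) = 0 := by
    simp [c, h0]
  obtain ⟨d, hd⟩ := ct_r0 hn _ ht
  rw [ct_sub, ct_smul, ct_one_r0, smul_zero, sub_zero] at hd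
  refine ⟨_, c, Rp_solve ht, ?_, ?_⟩
  · rw [hd]
    intro p q hq hpq
    rw [Matrix.sub_apply, Rp_inQ _ p q hq hpq, Matrix.smul_apply, Matrix.one_apply_ne hpq]
    simp
  · rw [hd, x_sub_lie, x_smul_lie, one_lie']
    simp

lemma rota {n : ℕ} (hn : 2 ≤ n) (α β : Mn n) :
    ⁅ct α (rCusp₀ n), ct β (rCusp₀ n)⁆ =
      ct (⁅ct α (rCusp₀ n), β⁆ + ⁅α, ct β (rCusp₀ n)⁆) (rCusp₀ n) := by
  obtain ⟨ν, c, hν, hu, hα⟩ := R_decomp hn α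
  obtain ⟨μ, d, hμ, hv, hβ⟩ := R_decomp hn β
  set u := ct α (rCusp₀ n)
  set v := ct β (rCusp₀ n)
  have key : ⁅u, β⁆ + ⁅α, v⁆ = ⁅⁅u, v⁆, Fn n⁆ + (⁅u, μ⁆ - ⁅v, ν⁆) := by
    rw [hα, hβ]
    simp only [Ring.lie_def, mul_add, add_mul, mul_sub, sub_mul, mul_assoc, smul_mul_assoc,
      mul_smul_comm, mul_one, one_mul]
    abel
  rw [key, ct_add, ct_sub, R_brF hn (hu.lie hv) (trace_br _ _), R_K hn (inK.lie hu hμ) (trace_br _ _),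
    R_K hn (inK.lie hv hν) (trace_br _ _)]
  simp

/-- contraction of legs two and three -/
def c3 {n : ℕ} (α β : Mn n) : Mn n ⊗[ℂ] (Mn n ⊗[ℂ] Mn n) →ₗ[ℂ] Mn n :=
  (TensorProduct.rid ℂ (Mn n)).toLinearMap ∘ₗ
    LinearMap.lTensor (Mn n) (LinearMap.mul' ℂ ℂ ∘ₗ TensorProduct.map (phi α) (phi β))

lemma c3_tmul {n : ℕ} (α β a b c : Mn n) :
    c3 α β (a ⊗ₜ[ℂ] (b ⊗ₜ[ℂ] c)) = (phi α b * phi β c) • a := by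
  simp [c3]

lemma c3_sep {n : ℕ} (t : Mn n ⊗[ℂ] (Mn n ⊗[ℂ] Mn n)) (h : ∀ α β, c3 α β t = 0) : t = 0 := by
  let B := Matrix.stdBasis ℂ (Fin n) (Fin n)
  let BB := B.tensorProduct (B.tensorProduct B)
  have hrep : ∀ (i : Fin n × Fin n) (j : Fin n × Fin n) (k : Fin n × Fin n)
      (t : Mn n ⊗[ℂ] (Mn n ⊗[ℂ] Mn n)),
      BB.repr t (i, j, k) = (c3 (Matrix.single j.2 j.1 1) (Matrix.single k.2 k.1 1) t) i.1 i.2 := by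
    intro i j k t
    have hB : ∀ (a : Mn n) (i : Fin n × Fin n), B.repr a i = a i.1 i.2 := by
      intro a i
      simp [B, Matrix.stdBasis]
    induction t using TensorProduct.induction_on with
    | zero => simp
    | add x y hx hy => simp only [map_add, Finsupp.add_apply, hx, hy, Matrix.add_apply]
    | tmul a s =>
      induction s using TensorProduct.induction_on with
      | zero => simp
      | add x y hx hy =>
        simp only [TensorProduct.tmul_add, map_add, Finsupp.add_apply, hx, hy, Matrix.add_apply]
      | tmul b c =>
        rw [c3_tmul]
        simp only [BB, Module.Basis.tensorProduct_repr_tmul_apply, hB, phi_apply,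
          Matrix.smul_apply, smul_eq_mul, Matrix.trace_mul_single]
        simp
        left; ring
  apply BB.ext_elem
  rintro ⟨i, j, k⟩
  rw [hrep, h]
  simp

lemma c3_1213 {n : ℕ} (B : (Mn n ⊗[ℂ] Mn n) →ₗ[ℂ] (Mn n ⊗[ℂ] Mn n) →ₗ[ℂ] (Mn n ⊗[ℂ] (Mn n ⊗[ℂ] Mn n)))
    (hB : ∀ a b c d : Mn n, B (a ⊗ₜ[ℂ] b) (c ⊗ₜ[ℂ] d) = ⁅a, c⁆ ⊗ₜ[ℂ] (b ⊗ₜ[ℂ] d))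
    (α β : Mn n) (r s : Mn n ⊗[ℂ] Mn n) : c3 α β (B r s) = ⁅ct α r, ct β s⁆ := by
  induction r using TensorProduct.induction_on with
  | zero => simp [x_zero_lie]
  | add x y hx hy => simp only [map_add, LinearMap.add_apply, hx, hy, x_add_lie]
  | tmul a b =>
    induction s using TensorProduct.induction_on with
    | zero => simp [x_lie_zero]
    | add x y hx hy => simp only [map_add, hx, hy, x_lie_add]
    | tmul c d => rw [hB, c3_tmul, ct_tmul, ct_tmul, x_smul_lie, x_lie_smul, smul_smul]

lemma phi_lie {n : ℕ} (α b c : Mn n) : phi α ⁅b, c⁆ = phi ⁅c, α⁆ b := by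
  simp only [phi_apply, Ring.lie_def, sub_mul, mul_sub, Matrix.trace_sub]
  rw [mul_assoc, Matrix.trace_mul_comm (c * b) α, Matrix.trace_mul_comm b (α * c), mul_assoc α c b]

lemma c3_1223 {n : ℕ} (B : (Mn n ⊗[ℂ] Mn n) →ₗ[ℂ] (Mn n ⊗[ℂ] Mn n) →ₗ[ℂ] (Mn n ⊗[ℂ] (Mn n ⊗[ℂ] Mn n)))
    (hB : ∀ a b c d : Mn n, B (a ⊗ₜ[ℂ] b) (c ⊗ₜ[ℂ] d) = a ⊗ₜ[ℂ] (⁅b, c⁆ ⊗ₜ[ℂ] d))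
    (α β : Mn n) (r s : Mn n ⊗[ℂ] Mn n) : c3 α β (B r s) = ct ⁅ct β s, α⁆ r := by
  induction r using TensorProduct.induction_on with
  | zero => simp [x_zero_lie]
  | add x y hx hy => simp only [map_add, LinearMap.add_apply, hx, hy]
  | tmul a b =>
    induction s using TensorProduct.induction_on with
    | zero => simp [ct_tmul, phi_apply, x_zero_lie]
    | add x y hx hy => simp only [map_add, hx, hy, x_add_lie, ct_add]
    | tmul c d =>
      rw [hB, c3_tmul, ct_tmul, ct_tmul, x_smul_lie, phi_lie, phi_smul, LinearMap.smul_apply,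
        smul_eq_mul, mul_comm]

lemma c3_1323 {n : ℕ} (B : (Mn n ⊗[ℂ] Mn n) →ₗ[ℂ] (Mn n ⊗[ℂ] Mn n) →ₗ[ℂ] (Mn n ⊗[ℂ] (Mn n ⊗[ℂ] Mn n)))
    (hB : ∀ a b c d : Mn n, B (a ⊗ₜ[ℂ] b) (c ⊗ₜ[ℂ] d) = a ⊗ₜ[ℂ] (c ⊗ₜ[ℂ] ⁅b, d⁆))
    (α β : Mn n) (r s : Mn n ⊗[ℂ] Mn n) :
    c3 α β (B r s) = ct ⁅ct α (TensorProduct.comm ℂ _ _ s), β⁆ r := by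
  induction r using TensorProduct.induction_on with
  | zero => simp [x_zero_lie]
  | add x y hx hy => simp only [map_add, LinearMap.add_apply, hx, hy]
  | tmul a b =>
    induction s using TensorProduct.induction_on with
    | zero => simp [ct_tmul, phi_apply, x_zero_lie]
    | add x y hx hy => simp only [map_add, hx, hy, x_add_lie, ct_add]
    | tmul c d =>
      rw [hB, c3_tmul, TensorProduct.comm_tmul, ct_tmul, ct_tmul, x_smul_lie, phi_lie, phi_smul,
        LinearMap.smul_apply, smul_eq_mul]

lemma comm_cas (n : ℕ) : TensorProduct.comm ℂ (Mn n) (Mn n) (casimirN n) = casimirN n := by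
  simp only [casimirN, map_add, map_sum, map_smul, TensorProduct.comm_tmul]
  congr 1
  · rw [Finset.sum_comm]
    apply Finset.sum_congr rfl; intro i _
    apply Finset.sum_congr rfl; intro j _
    by_cases h : i = j
    · simp [h]
    · rw [if_pos h, if_pos (Ne.symm h), TensorProduct.comm_tmul]
  · congr 1
    refine Finset.sum_bij' (fun j _ => n - j) (fun j _ => n - j) ?_ ?_ ?_ ?_ ?_
    · intro l hl; simp at hl ⊢; omega
    · intro l hl; simp at hl ⊢; omega
    · intro l hl; simp at hl ⊢; omega
    · intro l hl; simp at hl ⊢; omega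
    · intro l hl
      simp at hl
      have : n - (n - l) = l := by omega
      rw [this]

lemma zeta_sum {n : ℕ} (hn : 2 ≤ n) (p q : Fin n) :
    ∑ j ∈ Icc 1 (n - 1), ζ n (n - j) ^ (p : ℕ) * ζ n j ^ (q : ℕ)
      = (if p = q then (n : ℂ) else 0) - 1 := by
  have h0 : (n : ℂ) ≠ 0 := by exact_mod_cast (by omega : n ≠ 0)
  have hw : IsPrimitiveRoot (Complex.exp (2 * Real.pi * Complex.I / n)) n :=
    Complex.isPrimitiveRoot_exp n (by omega)
  set w := Complex.exp (2 * Real.pi * Complex.I / n) with hwdef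
  have hz : ∀ j, ζ n j = w ^ j := by
    intro j
    rw [ζ, hwdef, ← Complex.exp_nat_mul]
    congr 1; ring
  have hw0 : w ≠ 0 := hw.ne_zero (by omega)
  set η := w ^ (q : ℕ) * (w ^ (p : ℕ))⁻¹ with hη
  have hwn : w ^ n = 1 := hw.pow_eq_one
  have hterm : ∀ j ∈ Icc 1 (n - 1), ζ n (n - j) ^ (p : ℕ) * ζ n j ^ (q : ℕ) = η ^ j := by
    intro j hj
    rw [Finset.mem_Icc] at hj
    have e : w ^ (n - j) = (w ^ j)⁻¹ := by
      apply eq_inv_of_mul_eq_one_left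
      rw [← pow_add, Nat.sub_add_cancel (by omega), hwn]
    rw [hz, hz, e, hη, mul_pow, inv_pow, inv_pow, ← pow_mul, ← pow_mul, ← pow_mul, ← pow_mul,
      mul_comm j, mul_comm j]
    ring
  rw [Finset.sum_congr rfl hterm]
  have hs : ∑ j ∈ Icc 1 (n - 1), η ^ j = ∑ j ∈ range n, η ^ j - 1 := by
    have : range n = insert 0 (Icc 1 (n - 1)) := by ext x; simp; omega
    rw [this, Finset.sum_insert (by simp)]
    simp
  rw [hs]
  congr 1
  split_ifs with h
  · have : η = 1 := by rw [hη, h]; exact mul_inv_cancel₀ (pow_ne_zero _ hw0)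
    simp [this]
  · have h1 : η ≠ 1 := by
      intro h1
      apply h
      rw [hη, mul_inv_eq_one₀ (pow_ne_zero _ hw0)] at h1
      exact (Fin.ext (hw.pow_inj q.2 p.2 h1)).symm
    have h2 : η ^ n = 1 := by
      rw [hη, mul_pow, inv_pow, ← pow_mul, ← pow_mul, mul_comm _ n, mul_comm _ n, pow_mul, pow_mul,
        hwn]
      simp
    rw [geom_sum_eq h1, h2]; simp

lemma ct_cas {n : ℕ} (hn : 2 ≤ n) (α : Mn n) :
    ct α (casimirN n) = α - (Matrix.trace α / n) • (1 : Mn n) := by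
  have h0 : (n : ℂ) ≠ 0 := by exact_mod_cast (by omega : n ≠ 0)
  ext p q
  have hp := p.2
  have hq := q.2
  have H1 : (ct α (∑ i ∈ Icc 1 n, ∑ j ∈ Icc 1 n,
      if i ≠ j then Eb n i j ⊗ₜ[ℂ] Eb n j i else 0)) p q = if p = q then 0 else α p q := by
    simp only [map_sum, Matrix.sum_apply]
    rw [Finset.sum_eq_single ((p : ℕ) + 1), Finset.sum_eq_single ((q : ℕ) + 1)]
    · by_cases h : p = q
      · simp [h]
      · have h' : (p : ℕ) ≠ q := fun h2 => h (Fin.ext h2)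
        rw [if_neg h, if_pos (by omega), ct_tmul, phi_Eb, ex_fin]
        simp [Eb]
    · intro j _ hj
      split_ifs
      · rw [ct_tmul]
        simp only [Matrix.smul_apply, Eb, Matrix.of_apply]
        rw [if_neg (by omega), smul_zero]
      · simp
    · intro h; simp at h
    · intro i _ hi
      apply Finset.sum_eq_zero
      intro j _
      split_ifs
      · rw [ct_tmul]
        simp only [Matrix.smul_apply, Eb, Matrix.of_apply]
        rw [if_neg (by omega), smul_zero]
      · simp
    · intro h; simp at h
  have H2 : (ct α (∑ j ∈ Icc 1 (n - 1), gD n (n - j) ⊗ₜ[ℂ] gD n j)) p q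
      = if p = q then n * α p p - Matrix.trace α else 0 := by
    simp only [map_sum, Matrix.sum_apply, ct_tmul, Matrix.smul_apply, smul_eq_mul]
    split_ifs with h
    · subst h
      have e : ∀ j, phi α (gD n j) * gD n (n - j) p p
          = ∑ s : Fin n, (ζ n (n - j) ^ (p : ℕ) * ζ n j ^ (s : ℕ)) * α s s := by
        intro j
        simp only [phi_apply, gD, Matrix.trace, Matrix.diag, Matrix.diagonal_mul,
          Matrix.diagonal_apply_eq, Finset.sum_mul]
        apply Finset.sum_congr rfl
        intro s _
        ring
      simp only [e]
      rw [Finset.sum_comm]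
      simp only [← Finset.sum_mul, zeta_sum hn, sub_mul, one_mul, Finset.sum_sub_distrib]
      simp [Matrix.trace]
    · apply Finset.sum_eq_zero
      intro j _
      simp [gD, Matrix.diagonal_apply_ne _ h]
  rw [casimirN, map_add, map_smul, Matrix.add_apply, Matrix.smul_apply, H1, H2]
  simp only [Matrix.sub_apply, Matrix.smul_apply, Matrix.one_apply, smul_eq_mul]
  split_ifs with h
  · subst h; field_simp; ring
  · simp

/-- For `𝔤 = 𝔰𝔩ₙ(ℂ)`, `n ≥ 2`, the function
`r(x,y) = γ/(y−x) + Σ_{k=1}^{n−1} h_k* ∧ e_{k+1,k}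
  + Σ_{k ≥ l+2} (Σ_{j=0}^{l−1} e_{l−j,k−j−1}) ∧ e_{k,l}`
is a skew-symmetric solution of the classical Yang–Baxter equation. -/
theorem statement6
    (n : ℕ) (hn : 2 ≤ n)
    (B1213 B1223 B1323 :
      (Mn n ⊗[ℂ] Mn n) →ₗ[ℂ] (Mn n ⊗[ℂ] Mn n) →ₗ[ℂ] (Mn n ⊗[ℂ] (Mn n ⊗[ℂ] Mn n)))
    (hB1213 : ∀ a b c d : Mn n,
      B1213 (a ⊗ₜ[ℂ] b) (c ⊗ₜ[ℂ] d) = ⁅a, c⁆ ⊗ₜ[ℂ] (b ⊗ₜ[ℂ] d))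
    (hB1223 : ∀ a b c d : Mn n,
      B1223 (a ⊗ₜ[ℂ] b) (c ⊗ₜ[ℂ] d) = a ⊗ₜ[ℂ] (⁅b, c⁆ ⊗ₜ[ℂ] d))
    (hB1323 : ∀ a b c d : Mn n,
      B1323 (a ⊗ₜ[ℂ] b) (c ⊗ₜ[ℂ] d) = a ⊗ₜ[ℂ] (c ⊗ₜ[ℂ] ⁅b, d⁆))
    (r : ℂ → ℂ → Mn n ⊗[ℂ] Mn n)
    (hr : ∀ x y : ℂ, r x y = (y - x)⁻¹ • casimirN n + rCusp₀ n) :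
    (∀ x₁ x₂ x₃ : ℂ, x₁ ≠ x₂ → x₁ ≠ x₃ → x₂ ≠ x₃ →
        B1213 (r x₁ x₂) (r x₁ x₃) + B1223 (r x₁ x₂) (r x₂ x₃)
          + B1323 (r x₁ x₃) (r x₂ x₃) = 0)
      ∧ (∀ x y : ℂ, x ≠ y →
          r x y = - (TensorProduct.comm ℂ (Mn n) (Mn n) (r y x))) := by
  have comm_r : ∀ x y : ℂ, TensorProduct.comm ℂ (Mn n) (Mn n) (r x y)
      = (y - x)⁻¹ • casimirN n - rCusp₀ n := by
    intro x y
    rw [hr, map_add, map_smul, comm_cas, comm_r0]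
    exact (sub_eq_add_neg _ _).symm
  refine ⟨?_, ?_⟩
  · intro x₁ x₂ x₃ h12 h13 h23
    apply c3_sep
    intro α β
    rw [map_add, map_add, c3_1213 B1213 hB1213, c3_1223 B1223 hB1223, c3_1323 B1323 hB1323, comm_r,
      hr, hr, hr]
    have habc : (x₂ - x₁)⁻¹ * (x₃ - x₁)⁻¹ - (x₂ - x₁)⁻¹ * (x₃ - x₂)⁻¹
        + (x₃ - x₁)⁻¹ * (x₃ - x₂)⁻¹ = 0 := by
      have := sub_ne_zero.2 h12.symm
      have := sub_ne_zero.2 h13.symm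
      have := sub_ne_zero.2 h23.symm
      field_simp
      ring
    generalize (x₂ - x₁)⁻¹ = a at *
    generalize (x₃ - x₁)⁻¹ = b at *
    generalize (x₃ - x₂)⁻¹ = c at *
    have hrota := rota hn α β
    simp only [map_add, map_sub, map_smul, ct_cas hn, x_lie_add, x_add_lie, x_sub_lie, x_lie_sub,
      x_smul_lie, x_lie_smul, one_lie', lie_one', smul_zero, sub_zero, trace_br, Matrix.trace_add,
      Matrix.trace_sub, Matrix.trace_smul, zero_div, zero_smul, ct_add, ct_sub, ct_smul,
      add_zero, smul_add, smul_sub] at hrota ⊢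
    rw [hrota, ← x_lie_skew β α, ← x_lie_skew (ct β (rCusp₀ n)) α]
    simp only [ct_neg]
    linear_combination (norm := module) habc • ⁅α, β⁆
  · intro x y hxy
    rw [comm_r, hr, ← neg_sub y x, inv_neg]
    module

end
end
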